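/- Let n ≥ 5, set d = n(2n−1), let a_j = n−j for 1 ≤ j ≤ n, let ρ = (n−1, n−2, …, 1, 0) ∈ ℝⁿ, and define the multiplicity polynomial m(x) = ∏_{1≤i<l≤n} (x_i² − x_l²)² / ∏_{1≤j<l≤n} (a_j² − a_l²)². Define, for λ > 0, 𝓝(λ) = (1/(2^{n−1} n!)) Σ_{b∈ℤⁿ} m(b+ρ) · 1_{|b+ρ|² ≤ λ + |ρ|²}. Then as λ → ∞, 𝓝(λ) = C λ^{d/2} + O(λ^{(d−2)/2}), where C = (1/(2^{n−1} n!)) ∫_{|x|≤1} m(x) dx. -/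

import Mathlib

open MeasureTheory Filter Asymptotics Finset

namespace WeylLaw

section

/-- The one-dimensional theta series with weight `b ^ (2 * j)`. -/
noncomputable def theta (j : ℕ) (s : ℂ) : ℂ := ∑' b : ℤ, (b : ℂ) ^ (2 * j) * Complex.exp (-s * b ^ 2)

lemma norm_theta_term (j : ℕ) (s : ℂ) (b : ℤ) :
    ‖(b : ℂ) ^ (2 * j) * Complex.exp (-s * b ^ 2)‖ = (b : ℝ) ^ (2 * j) * Real.exp (-s.re * b ^ 2) := by
  have h1 : ‖(b : ℂ) ^ (2 * j)‖ = (b : ℝ) ^ (2 * j) := by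
    rw [norm_pow, Complex.norm_intCast, pow_mul, sq_abs, ← pow_mul]
  have h2 : (-s * (b : ℂ) ^ 2).re = -s.re * b ^ 2 := by
    rw [show -s * (b : ℂ) ^ 2 = ((b ^ 2 : ℝ) : ℂ) * -s by push_cast; ring, Complex.re_ofReal_mul]
    simp [mul_comm]
  rw [norm_mul, h1, Complex.norm_exp, h2]

lemma summable_pow_mul_exp_neg_sq (j : ℕ) {T : ℝ} (hT : 0 < T) :
    Summable fun b : ℤ => (b : ℝ) ^ (2 * j) * Real.exp (-T * b ^ 2) := by
  have h := summable_pow_mul_jacobiTheta₂_term_bound 0 (T := T / Real.pi) (by positivity) (2 * j)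
  refine h.congr fun b => ?_
  congr 1
  · push_cast; rw [pow_mul, sq_abs, ← pow_mul]
  · congr 1; field_simp; ring

lemma summable_theta_term (j : ℕ) {s : ℂ} (hs : 0 < s.re) :
    Summable fun b : ℤ => (b : ℂ) ^ (2 * j) * Complex.exp (-s * b ^ 2) := by
  rw [← summable_norm_iff]
  simpa only [norm_theta_term] using summable_pow_mul_exp_neg_sq j hs

lemma hasDerivAt_theta (j : ℕ) {s : ℂ} (hs : 0 < s.re) :
    HasDerivAt (theta j) (-theta (j + 1) s) s := by
  have hopen : IsOpen {z : ℂ | s.re / 2 < z.re} := isOpen_lt continuous_const Complex.continuous_re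
  have hconn : IsPreconnected {z : ℂ | s.re / 2 < z.re} := (convex_halfSpace_re_gt _).isPreconnected
  have hmem : s ∈ {z : ℂ | s.re / 2 < z.re} := by simp only [Set.mem_ofPred_eq]; linarith
  have key := hasDerivAt_tsum_of_isPreconnected
    (g := fun (b : ℤ) (z : ℂ) => (b : ℂ) ^ (2 * j) * Complex.exp (-z * b ^ 2))
    (g' := fun (b : ℤ) (z : ℂ) => -((b : ℂ) ^ (2 * (j + 1)) * Complex.exp (-z * b ^ 2)))
    (summable_pow_mul_exp_neg_sq (j + 1) (half_pos hs)) hopen hconn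
    (fun b z _ => by
      have : HasDerivAt (fun z : ℂ => -z * (b : ℂ) ^ 2) (-1 * (b : ℂ) ^ 2) z :=
        (hasDerivAt_id z).neg.mul_const _
      exact (this.cexp.const_mul ((b : ℂ) ^ (2 * j))).congr_deriv (by ring))
    (fun b z hz => by
      rw [norm_neg, norm_theta_term]
      have : s.re / 2 < z.re := hz
      have h0 : (0 : ℝ) ≤ (b : ℝ) ^ (2 * (j + 1)) := by rw [pow_mul]; positivity
      gcongr)
    hmem (summable_theta_term j hs) hmem
  rw [tsum_neg] at key
  exact key

/-- Cauchy estimate along a chain of derivatives. -/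
lemma norm_chain_le {F : ℕ → ℂ → ℂ} {U : Set ℂ} (hU : IsOpen U)
    (hF : ∀ j, ∀ z ∈ U, HasDerivAt (F j) (F (j + 1) z) z) (j : ℕ) {s : ℂ} {r M : ℝ} (hr : 0 < r)
    (hball : Metric.closedBall s r ⊆ U) (hM : ∀ z ∈ Metric.closedBall s r, ‖F 0 z‖ ≤ M) :
    ‖F j s‖ ≤ j.factorial * M / r ^ j := by
  have hiter : ∀ k, ∀ z ∈ U, iteratedDeriv k (F 0) z = F k z := by
    intro k
    induction k with
    | zero => intro z _; simp
    | succ k ih =>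
      intro z hz
      rw [iteratedDeriv_succ]
      have : iteratedDeriv k (F 0) =ᶠ[nhds z] F k := by
        filter_upwards [hU.mem_nhds hz] with w hw using ih w hw
      rw [this.deriv_eq, (hF k z hz).deriv]
  rw [← hiter j s (hball (Metric.mem_closedBall_self hr.le))]
  refine Complex.norm_iteratedDeriv_le_of_forall_mem_sphere_norm_le j hr ?_
    fun z hz => hM z (Metric.sphere_subset_closedBall hz)
  refine DifferentiableOn.diffContOnCl_ball (U := U) (fun z hz => ?_) hball
  exact (hF 0 z hz).differentiableAt.differentiableWithinAt

section GaussSum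

variable {q : ℕ} [NeZero q]

/-- The quadratic Gauss sum modulo `q`. -/
noncomputable def gaussQuad (a k : ZMod q) : ℂ := ∑ r : ZMod q, ZMod.stdAddChar (a * r ^ 2 + k * r)

lemma card_two_mul_eq_zero_le (a : ZMod q) (ha : IsUnit a) :
    #{h : ZMod q | 2 * a * h = 0} ≤ 2 := by
  have hsub : ({h : ZMod q | 2 * a * h = 0} : Finset (ZMod q)) ⊆ ({0, ((q / 2 : ℕ) : ZMod q)} : Finset (ZMod q)) := by
    intro h hh
    simp only [Finset.mem_filter, Finset.mem_univ, true_and, Finset.mem_insert,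
      Finset.mem_singleton] at hh ⊢
    have h2 : (2 : ZMod q) * h = 0 := by
      have : a * (2 * h) = 0 := by rw [← hh]; ring
      exact (ha.mul_right_eq_zero).1 this
    have hval : ((2 * h.val : ℕ) : ZMod q) = 0 := by
      push_cast; rw [ZMod.natCast_zmod_val]; exact h2
    rw [ZMod.natCast_eq_zero_iff] at hval
    have hlt := ZMod.val_lt h
    obtain ⟨c, hc⟩ := hval
    have hc2 : c < 2 := by
      by_contra hcon
      have : q * 2 ≤ q * c := Nat.mul_le_mul_left _ (by omega)
      omega
    interval_cases c
    · left; rw [← ZMod.val_eq_zero]; omega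
    · right
      have : h.val = q / 2 := by omega
      rw [← this, ZMod.natCast_zmod_val]
  exact (Finset.card_le_card hsub).trans (Finset.card_le_two)

lemma norm_gaussQuad_le (a k : ZMod q) (ha : IsUnit a) : ‖gaussQuad a k‖ ≤ √(2 * q) := by
  apply Real.le_sqrt_of_sq_le
  have hsq : ((‖gaussQuad a k‖ ^ 2 : ℝ) : ℂ) =
      ∑ h : ZMod q, ZMod.stdAddChar (a * h ^ 2 + k * h) *
        ((if 2 * a * h = 0 then Fintype.card (ZMod q) else 0 : ℕ) : ℂ) := by
    push_cast [← Complex.conj_mul']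
    calc (starRingEnd ℂ) (gaussQuad a k) * gaussQuad a k
        = ∑ r : ZMod q, ∑ h : ZMod q, ZMod.stdAddChar (-(a * r ^ 2 + k * r)) *
            ZMod.stdAddChar (a * h ^ 2 + k * h) := by
          rw [gaussQuad, map_sum, Finset.sum_mul_sum]
          simp_rw [AddChar.map_neg_eq_conj]
      _ = ∑ r : ZMod q, ∑ h : ZMod q, ZMod.stdAddChar (a * h ^ 2 + k * h) *
            ZMod.stdAddChar (r * (2 * a * h)) := by
          refine Finset.sum_congr rfl fun r _ => ?_
          rw [← Equiv.sum_comp (Equiv.addRight r)]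
          refine Finset.sum_congr rfl fun h _ => ?_
          rw [← AddChar.map_add_eq_mul, ← AddChar.map_add_eq_mul, Equiv.coe_addRight]
          congr 1; ring
      _ = _ := by
          rw [Finset.sum_comm]
          refine Finset.sum_congr rfl fun h _ => ?_
          rw [← Finset.mul_sum, AddChar.sum_mulShift _ (ZMod.isPrimitive_stdAddChar q)]
          push_cast; rfl
  have h1 : ‖gaussQuad a k‖ ^ 2 = ‖((‖gaussQuad a k‖ ^ 2 : ℝ) : ℂ)‖ := by
    rw [Complex.norm_real, Real.norm_of_nonneg (by positivity)]
  rw [h1, hsq]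
  calc _ ≤ ∑ h : ZMod q, ((if 2 * a * h = 0 then Fintype.card (ZMod q) else 0 : ℕ) : ℝ) := by
        refine (norm_sum_le _ _).trans (Finset.sum_le_sum fun h _ => ?_)
        rw [norm_mul, AddChar.norm_apply, one_mul, Complex.norm_natCast]
    _ = (#{h : ZMod q | 2 * a * h = 0} : ℝ) * q := by
        rw [← Nat.cast_sum, ← Finset.sum_filter, Finset.sum_const, ZMod.card, smul_eq_mul,
          Nat.cast_mul]
    _ ≤ 2 * q := by
        gcongr; exact_mod_cast card_two_mul_eq_zero_le a ha

end GaussSum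

end

lemma sum_fin_natCast_zmod {q : ℕ} [NeZero q] (f : ZMod q → ℂ) :
    ∑ r : Fin q, f ((r : ℕ) : ZMod q) = ∑ x : ZMod q, f x := by
  obtain _ | q := q
  · exact absurd rfl (NeZero.ne 0)
  · exact Finset.sum_congr rfl fun r _ => by
      congr 1
      exact ZMod.natCast_zmod_val (n := q + 1) r

lemma tsum_int_eq_sum_residues {q : ℕ} [NeZero q] {g : ℤ → ℂ} (hg : Summable g) :
    ∑' b, g b = ∑ r : Fin q, ∑' m : ℤ, g (r + m * q) := by
  have h1 := (Int.divModEquiv q).symm.tsum_eq g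
  have h2 : Summable fun p : ℤ × Fin q => g ((Int.divModEquiv q).symm p) :=
    (Int.divModEquiv q).symm.summable_iff.2 hg
  have h3 : Summable fun p : Fin q × ℤ => g ((Int.divModEquiv q).symm p.swap) :=
    h2.prod_symm
  rw [← h1, ← (Equiv.prodComm (Fin q) ℤ).tsum_eq, ← tsum_fintype (L := .unconditional _)]
  refine h3.tsum_prod.trans ?_
  refine tsum_congr fun r => tsum_congr fun m => ?_
  simp [Int.divModEquiv, add_comm]

lemma tsum_exp_residue {q : ℕ} [NeZero q] {s : ℂ} (hs : 0 < s.re) (r : ℕ) :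
    ∑' m : ℤ, Complex.exp (-s * ((r + m * q : ℤ) : ℂ) ^ 2) =
      1 / (s * q ^ 2 / Real.pi) ^ (1 / 2 : ℂ) *
        ∑' k : ℤ, Complex.exp (-Real.pi ^ 2 * k ^ 2 / (s * q ^ 2)) *
          ZMod.stdAddChar ((k : ZMod q) * (r : ZMod q)) := by
  have hq : (q : ℂ) ≠ 0 := Nat.cast_ne_zero.2 (NeZero.ne q)
  have hpi : (Real.pi : ℂ) ≠ 0 := Complex.ofReal_ne_zero.2 Real.pi_ne_zero
  have hs0 : s ≠ 0 := by rintro rfl; simp at hs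
  have hA : 0 < (s * q ^ 2 / Real.pi : ℂ).re := by
    have : (s * q ^ 2 / Real.pi : ℂ) = ((q ^ 2 / Real.pi : ℝ) : ℂ) * s := by push_cast; ring
    rw [this, Complex.re_ofReal_mul]
    have : (0 : ℝ) < q := Nat.cast_pos.2 (NeZero.pos q)
    positivity
  have key := Complex.tsum_exp_neg_quadratic hA (-s * q * r / Real.pi)
  have h1 : ∀ m : ℤ, Complex.exp (-s * ((r + m * q : ℤ) : ℂ) ^ 2) = Complex.exp (-s * r ^ 2) *
      Complex.exp (-Real.pi * (s * q ^ 2 / Real.pi) * m ^ 2 +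
        2 * Real.pi * (-s * q * r / Real.pi) * m) := by
    intro m
    rw [← Complex.exp_add]
    congr 1
    push_cast
    field_simp
    ring
  simp_rw [h1, tsum_mul_left, key]
  rw [mul_left_comm, ← tsum_mul_left]
  congr 1
  refine tsum_congr fun k => ?_
  have h2 : ZMod.stdAddChar ((k : ZMod q) * (r : ZMod q)) =
      Complex.exp (2 * Real.pi * Complex.I * ((k * r : ℤ) : ℂ) / q) := by
    rw [← ZMod.stdAddChar_coe]; push_cast; rfl
  rw [h2, ← Complex.exp_add, ← Complex.exp_add]
  congr 1
  push_cast
  field_simp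
  ring_nf
  simp only [Complex.I_sq]
  ring

lemma summable_exp_neg_div {c : ℝ} (hc : 0 < c) :
    Summable fun k : ℤ => Real.exp (-c * k ^ 2) := by
  simpa using summable_pow_mul_exp_neg_sq 0 hc

lemma norm_exp_dual (s : ℂ) (q : ℕ) (k : ℤ) :
    ‖Complex.exp (-Real.pi ^ 2 * k ^ 2 / (s * q ^ 2))‖ =
      Real.exp (-(Real.pi ^ 2 * (s.re / (q ^ 2 * ‖s‖ ^ 2))) * k ^ 2) := by
  rw [Complex.norm_exp]
  congr 1
  have : (-Real.pi ^ 2 * k ^ 2 / (s * q ^ 2) : ℂ) = ((-Real.pi ^ 2 * k ^ 2 / q ^ 2 : ℝ) : ℂ) * s⁻¹ := by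
    push_cast
    rw [div_eq_mul_inv, mul_inv]
    ring
  rw [this, Complex.re_ofReal_mul, Complex.inv_re, Complex.normSq_eq_norm_sq]
  rw [div_mul_div_comm]
  ring

lemma theta_zero_add_rational {q : ℕ} [NeZero q] {s : ℂ} (hs : 0 < s.re) (a : ℤ) :
    theta 0 (s + 2 * Real.pi * Complex.I * a / q) =
      1 / (s * q ^ 2 / Real.pi) ^ (1 / 2 : ℂ) *
        ∑' k : ℤ, Complex.exp (-Real.pi ^ 2 * k ^ 2 / (s * q ^ 2)) *
          gaussQuad (-(a : ZMod q)) (k : ZMod q) := by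
  have hq0 : (0 : ℝ) < q := Nat.cast_pos.2 (NeZero.pos q)
  have hre : (s + 2 * Real.pi * Complex.I * a / q).re = s.re := by
    have : (2 * Real.pi * Complex.I * a / q : ℂ) = ((2 * Real.pi * a / q : ℝ) : ℂ) * Complex.I := by
      push_cast; ring
    rw [this, Complex.add_re, Complex.re_ofReal_mul]; simp
  have hs0 : s ≠ 0 := by rintro rfl; simp at hs
  have hterm : ∀ b : ℤ, (b : ℂ) ^ (2 * 0) *
      Complex.exp (-(s + 2 * Real.pi * Complex.I * a / q) * b ^ 2) =
      ZMod.stdAddChar (-(a : ZMod q) * (b : ZMod q) ^ 2) * Complex.exp (-s * b ^ 2) := by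
    intro b
    have h2 : ZMod.stdAddChar (-(a : ZMod q) * (b : ZMod q) ^ 2) =
        Complex.exp (2 * Real.pi * Complex.I * ((-a * b ^ 2 : ℤ) : ℂ) / q) := by
      rw [← ZMod.stdAddChar_coe]; push_cast; rfl
    rw [h2, ← Complex.exp_add]
    simp only [mul_zero, pow_zero, one_mul]
    congr 1
    push_cast
    ring
  have hsum := summable_theta_term 0 (s := s + 2 * Real.pi * Complex.I * a / q) (by rwa [hre])
  rw [theta]
  rw [tsum_int_eq_sum_residues (q := q) hsum]
  have hr : ∀ r : Fin q, (∑' m : ℤ, ((r + m * q : ℤ) : ℂ) ^ (2 * 0) *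
      Complex.exp (-(s + 2 * Real.pi * Complex.I * a / q) * ((r + m * q : ℤ) : ℂ) ^ 2)) =
      ZMod.stdAddChar (-(a : ZMod q) * ((r : ℕ) : ZMod q) ^ 2) *
      (1 / (s * q ^ 2 / Real.pi) ^ (1 / 2 : ℂ) *
        ∑' k : ℤ, Complex.exp (-Real.pi ^ 2 * k ^ 2 / (s * q ^ 2)) *
          ZMod.stdAddChar ((k : ZMod q) * ((r : ℕ) : ZMod q))) := by
    intro r
    rw [← tsum_exp_residue hs, ← tsum_mul_left]
    refine tsum_congr fun m => ?_
    rw [hterm]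
    congr 2
    push_cast
    simp
  simp_rw [hr]
  rw [sum_fin_natCast_zmod (fun x : ZMod q => ZMod.stdAddChar (-(a : ZMod q) * x ^ 2) *
      (1 / (s * q ^ 2 / Real.pi) ^ (1 / 2 : ℂ) *
        ∑' k : ℤ, Complex.exp (-Real.pi ^ 2 * k ^ 2 / (s * q ^ 2)) *
          ZMod.stdAddChar ((k : ZMod q) * x)))]
  have hS : ∀ x : ZMod q, Summable fun k : ℤ => ZMod.stdAddChar (-(a : ZMod q) * x ^ 2) *
      (Complex.exp (-Real.pi ^ 2 * k ^ 2 / (s * q ^ 2)) * ZMod.stdAddChar ((k : ZMod q) * x)) := by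
    intro x
    refine Summable.mul_left _ ?_
    rw [← summable_norm_iff]
    simp_rw [norm_mul, AddChar.norm_apply, mul_one, norm_exp_dual]
    exact summable_exp_neg_div (by have := norm_pos_iff.2 hs0; positivity)
  simp_rw [mul_left_comm _ (1 / (s * q ^ 2 / Real.pi) ^ (1 / 2 : ℂ)), ← Finset.mul_sum,
    ← tsum_mul_left]
  rw [← Summable.tsum_finsetSum fun x _ => hS x, tsum_mul_left]
  congr 1
  refine tsum_congr fun k => ?_
  rw [gaussQuad, Finset.mul_sum]
  refine Finset.sum_congr rfl fun x _ => ?_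
  rw [AddChar.map_add_eq_mul]
  ring

lemma norm_one_div_cpow_half (s : ℂ) : ‖1 / s ^ (1 / 2 : ℂ)‖ = (√‖s‖)⁻¹ := by
  have : (1 / 2 : ℂ) = ((1 / 2 : ℝ) : ℂ) := by push_cast; rfl
  rw [norm_div, norm_one, this, Complex.norm_cpow_real, ← Real.sqrt_eq_rpow, one_div]

lemma ofReal_mul_cpow_half {r : ℝ} (hr : 0 < r) {s : ℂ} (hs : s ≠ 0) :
    ((r : ℂ) * s) ^ (1 / 2 : ℂ) = √r * s ^ (1 / 2 : ℂ) := by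
  have h1 : ((√r : ℝ) : ℂ) = (r : ℂ) ^ (1 / 2 : ℂ) := by
    rw [Real.sqrt_eq_rpow, Complex.ofReal_cpow hr.le]
    push_cast; rfl
  have hr0 : (r : ℂ) ≠ 0 := by exact_mod_cast hr.ne'
  rw [h1, Complex.cpow_def_of_ne_zero (mul_ne_zero hr0 hs), Complex.cpow_def_of_ne_zero hr0,
    Complex.cpow_def_of_ne_zero hs, Complex.log_ofReal_mul hr hs, ← Complex.exp_add,
    Complex.ofReal_log hr.le]
  ring_nf

lemma exists_norm_theta_zero_le : ∃ C : ℝ, 0 < C ∧ ∀ (q : ℕ) (a : ℤ) (s : ℂ), 0 < q →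
    IsCoprime a (q : ℤ) → 0 < s.re → q ^ 2 * ‖s‖ ^ 2 ≤ 288 * s.re →
    ‖theta 0 (s + 2 * Real.pi * Complex.I * a / q)‖ ≤ C * (√(q * ‖s‖))⁻¹ := by
  set D : ℝ := ∑' k : ℤ, Real.exp (-(Real.pi ^ 2 / 288) * k ^ 2) with hD
  have hDs : Summable fun k : ℤ => Real.exp (-(Real.pi ^ 2 / 288) * k ^ 2) :=
    summable_exp_neg_div (by positivity)
  have hD0 : 0 < D := hDs.tsum_pos (fun _ => (Real.exp_pos _).le) 0 (Real.exp_pos _)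
  refine ⟨√(2 * Real.pi) * D, by positivity, fun q a s hq hcop hs hle => ?_⟩
  have : NeZero q := ⟨hq.ne'⟩
  have hs0 : s ≠ 0 := by rintro rfl; simp at hs
  have hs1 : 0 < ‖s‖ := norm_pos_iff.2 hs0
  have hq1 : (0 : ℝ) < q := Nat.cast_pos.2 hq
  have hunit : IsUnit (-(a : ZMod q)) := by
    rw [IsUnit.neg_iff]
    exact (ZMod.coe_int_isUnit_iff_isCoprime a q).2 hcop.symm
  have hterm : ∀ k : ℤ, ‖Complex.exp (-Real.pi ^ 2 * k ^ 2 / (s * q ^ 2)) *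
      gaussQuad (-(a : ZMod q)) (k : ZMod q)‖ ≤
      √(2 * q) * Real.exp (-(Real.pi ^ 2 / 288) * k ^ 2) := by
    intro k
    rw [norm_mul, norm_exp_dual, mul_comm]
    refine mul_le_mul (norm_gaussQuad_le _ _ hunit) ?_ (Real.exp_pos _).le (by positivity)
    apply Real.exp_le_exp.2
    have : 1 / 288 ≤ s.re / (q ^ 2 * ‖s‖ ^ 2) := by
      rw [div_le_div_iff₀ (by norm_num) (by positivity)]; linarith
    have h2 : Real.pi ^ 2 / 288 ≤ Real.pi ^ 2 * (s.re / (q ^ 2 * ‖s‖ ^ 2)) := by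
      rw [div_eq_mul_one_div]; gcongr
    have h3 : (0 : ℝ) ≤ (k : ℝ) ^ 2 := by positivity
    nlinarith
  rw [theta_zero_add_rational hs, norm_mul, norm_one_div_cpow_half]
  have h1 := tsum_of_norm_bounded (hDs.mul_left (√(2 * q))).hasSum hterm
  rw [tsum_mul_left] at h1
  refine (mul_le_mul_of_nonneg_left h1 (by positivity)).trans (le_of_eq ?_)
  have h2 : ‖s * q ^ 2 / Real.pi‖ = ‖s‖ * q ^ 2 / Real.pi := by
    simp [abs_of_pos Real.pi_pos]
  rw [h2, ← hD, ← Real.sqrt_inv, ← Real.sqrt_inv, ← mul_assoc,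
    ← Real.sqrt_mul (by positivity), mul_right_comm, ← Real.sqrt_mul (by positivity)]
  congr 2
  field_simp

lemma exists_norm_theta_zero_sub_le : ∃ C : ℝ, 0 < C ∧ ∀ s : ℂ, 0 < s.re →
    ‖s‖ ^ 2 ≤ 288 * s.re →
    ‖theta 0 s - √Real.pi * (1 / s ^ (1 / 2 : ℂ))‖ ≤
      C * ((√‖s‖)⁻¹ * (‖s‖ ^ 2 / s.re) ^ 2) := by
  set D : ℝ := ∑' k : ℤ, Real.exp (-(Real.pi ^ 2 / 576) * k ^ 2) with hD
  have hDs : Summable fun k : ℤ => Real.exp (-(Real.pi ^ 2 / 576) * k ^ 2) :=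
    summable_exp_neg_div (by positivity)
  have hD0 : 0 < D := hDs.tsum_pos (fun _ => (Real.exp_pos _).le) 0 (Real.exp_pos _)
  refine ⟨√Real.pi * D, by positivity, fun s hs hle => ?_⟩
  have hs0 : s ≠ 0 := by rintro rfl; simp at hs
  have hs1 : 0 < ‖s‖ := norm_pos_iff.2 hs0
  have hpi := Real.pi_pos
  have hre : 0 < (s / Real.pi : ℂ).re := by
    rw [Complex.div_ofReal_re]; positivity
  have hP : theta 0 s = 1 / (s / Real.pi) ^ (1 / 2 : ℂ) *
      ∑' k : ℤ, Complex.exp (-Real.pi ^ 2 * k ^ 2 / (s * (1 : ℕ) ^ 2)) := by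
    have := Complex.tsum_exp_neg_quadratic hre 0
    rw [theta]
    convert this using 2
    · ext b
      have : (Real.pi : ℂ) ≠ 0 := by exact_mod_cast hpi.ne'
      simp only [mul_zero, pow_zero, one_mul, zero_mul, add_zero]
      congr 1; field_simp
    · refine tsum_congr fun k => ?_
      congr 1
      simp only [mul_zero, add_zero, Nat.cast_one, one_pow, mul_one]
      field_simp
  have hB : √Real.pi * (1 / s ^ (1 / 2 : ℂ)) = 1 / (s / Real.pi) ^ (1 / 2 : ℂ) := by
    have h1 : s = ((Real.pi : ℝ) : ℂ) * (s / Real.pi) := by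
      have : (Real.pi : ℂ) ≠ 0 := by exact_mod_cast hpi.ne'
      field_simp
    have h2 : s ^ (1 / 2 : ℂ) = √Real.pi * (s / Real.pi) ^ (1 / 2 : ℂ) := by
      conv_lhs => rw [h1]
      rw [ofReal_mul_cpow_half hpi (by rintro h; rw [h] at hre; simp at hre)]
    have h3 : (√Real.pi : ℂ) ≠ 0 := by
      exact_mod_cast (Real.sqrt_pos.2 hpi).ne'
    rw [h2]
    field_simp
  have hsum : Summable fun k : ℤ => Complex.exp (-Real.pi ^ 2 * k ^ 2 / (s * (1 : ℕ) ^ 2)) := by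
    rw [← summable_norm_iff]
    simp_rw [norm_exp_dual]
    exact summable_exp_neg_div (by positivity)
  have hterm : ∀ k : ℤ, ‖if k = 0 then 0 else
      Complex.exp (-Real.pi ^ 2 * k ^ 2 / (s * (1 : ℕ) ^ 2))‖ ≤
      (‖s‖ ^ 2 / s.re) ^ 2 * Real.exp (-(Real.pi ^ 2 / 576) * k ^ 2) := by
    intro k
    split_ifs with hk
    · rw [norm_zero]; positivity
    rw [norm_exp_dual]
    set x := s.re / ‖s‖ ^ 2 with hx
    have hx0 : 0 < x := by positivity
    have hx1 : 1 / 288 ≤ x := by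
      rw [hx, div_le_div_iff₀ (by norm_num) (by positivity)]; linarith
    have hk1 : (1 : ℝ) ≤ (k : ℝ) ^ 2 := by
      have : (1 : ℤ) ≤ k ^ 2 := by
        have := sq_nonneg k; have : k ^ 2 ≠ 0 := pow_ne_zero 2 hk; omega
      exact_mod_cast this
    have h1 : (‖s‖ ^ 2 / s.re) ^ 2 = (x ^ 2)⁻¹ := by rw [hx]; field_simp
    have h2 : Real.exp (-(Real.pi ^ 2 * x / 2)) ≤ (x ^ 2)⁻¹ := by
      rw [Real.exp_neg]
      apply inv_anti₀ (by positivity)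
      have h3 := Real.quadratic_le_exp_of_nonneg (x := Real.pi ^ 2 * x / 2) (by positivity)
      have h4 : (9 : ℝ) ≤ Real.pi ^ 2 := by nlinarith [Real.pi_gt_three]
      have h5 : 2 * x ≤ Real.pi ^ 2 * x / 2 := by nlinarith
      have h6 : (2 * x) ^ 2 ≤ (Real.pi ^ 2 * x / 2) ^ 2 := by gcongr
      nlinarith
    have h3 : s.re / ((1 : ℕ) ^ 2 * ‖s‖ ^ 2) = x := by simp [hx]
    rw [h1, h3]
    refine le_trans ?_ (mul_le_mul_of_nonneg_right h2 (Real.exp_pos _).le)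
    rw [← Real.exp_add]
    apply Real.exp_le_exp.2
    have h4 : 0 < Real.pi ^ 2 := by positivity
    have h5 : Real.pi ^ 2 * x * k ^ 2 = Real.pi ^ 2 * x * k ^ 2 / 2 + Real.pi ^ 2 * x * k ^ 2 / 2 := by ring
    have h6 : Real.pi ^ 2 * x / 2 ≤ Real.pi ^ 2 * x * k ^ 2 / 2 := by
      have : 0 < Real.pi ^ 2 * x := by positivity
      nlinarith
    have h7 : Real.pi ^ 2 / 576 * k ^ 2 ≤ Real.pi ^ 2 * x * k ^ 2 / 2 := by
      have : 0 ≤ Real.pi ^ 2 * (k : ℝ) ^ 2 := by positivity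
      nlinarith
    nlinarith
  have hsplit := hsum.tsum_eq_add_tsum_ite 0
  rw [hB, hP, hsplit]
  have h0 : Complex.exp (-Real.pi ^ 2 * ((0 : ℤ) : ℂ) ^ 2 / (s * (1 : ℕ) ^ 2)) = 1 := by simp
  rw [h0, mul_add, mul_one, add_sub_cancel_left, norm_mul, norm_one_div_cpow_half]
  have h1 := tsum_of_norm_bounded (hDs.mul_left ((‖s‖ ^ 2 / s.re) ^ 2)).hasSum hterm
  rw [tsum_mul_left] at h1
  refine (mul_le_mul_of_nonneg_left h1 (by positivity)).trans (le_of_eq ?_)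
  have h2 : ‖s / Real.pi‖ = ‖s‖ / Real.pi := by
    simp [abs_of_pos Real.pi_pos]
  rw [h2, ← hD, Real.sqrt_div (by positivity), inv_div]
  ring

lemma isOpen_re_pos : IsOpen {z : ℂ | 0 < z.re} := isOpen_lt continuous_const Complex.continuous_re

lemma mem_closedBall_half_re {s z : ℂ} (hz : z ∈ Metric.closedBall s (s.re / 2)) :
    s.re / 2 ≤ z.re ∧ ‖z‖ ≤ 3 / 2 * ‖s‖ ∧ ‖s‖ / 2 ≤ ‖z‖ := by
  rw [mem_closedBall_iff_norm] at hz
  have h1 := (Complex.abs_re_le_norm (z - s)).trans hz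
  rw [Complex.sub_re, abs_le] at h1
  have h2 := (Complex.re_le_norm s)
  have h3 := norm_sub_norm_le z s
  have h4 := norm_sub_norm_le s z
  rw [norm_sub_rev] at h4
  exact ⟨by linarith [h1.1], by linarith, by linarith⟩

lemma inv_sqrt_half_le {x y : ℝ} (hx : 0 < x) (hy : x / 2 ≤ y) : (√y)⁻¹ ≤ 2 * (√x)⁻¹ := by
  have h1 : √x / 2 ≤ √y := by
    apply Real.le_sqrt_of_sq_le
    rw [div_pow, Real.sq_sqrt hx.le]; linarith
  have h2 : 0 < √x := Real.sqrt_pos.2 hx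
  calc (√y)⁻¹ ≤ (√x / 2)⁻¹ := inv_anti₀ (by positivity) h1
    _ = 2 * (√x)⁻¹ := by rw [inv_div]; rfl

/-- Bound for the theta series near the rational point `a / q`. -/
lemma exists_norm_theta_le (j : ℕ) : ∃ C : ℝ, 0 < C ∧ ∀ (q : ℕ) (a : ℤ) (s : ℂ), 0 < q →
    IsCoprime a (q : ℤ) → 0 < s.re → q ^ 2 * ‖s‖ ^ 2 ≤ 64 * s.re →
    ‖theta j (s + 2 * Real.pi * Complex.I * a / q)‖ ≤ C * ((s.re ^ j)⁻¹ * (√(q * ‖s‖))⁻¹) := by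
  obtain ⟨C, hC, H⟩ := exists_norm_theta_zero_le
  refine ⟨j.factorial * (2 * C) * 2 ^ j, by positivity, fun q a s hq hcop hs hle => ?_⟩
  have hq1 : (0 : ℝ) < q := Nat.cast_pos.2 hq
  have hs1 : 0 < ‖s‖ := norm_pos_iff.2 (by rintro rfl; simp at hs)
  have hre : (2 * Real.pi * Complex.I * a / q : ℂ).re = 0 := by
    have : (2 * Real.pi * Complex.I * a / q : ℂ) = ((2 * Real.pi * a / q : ℝ) : ℂ) * Complex.I := by
      push_cast; ring
    rw [this, Complex.re_ofReal_mul]; simp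
  have key := norm_chain_le (F := fun j z => (-1) ^ j * theta j (z + 2 * Real.pi * Complex.I * a / q))
    isOpen_re_pos (fun j z hz => by
      have hz' : 0 < (z + 2 * Real.pi * Complex.I * a / q).re := by
        rw [Complex.add_re, hre, add_zero]; exact hz
      have h1 := ((hasDerivAt_theta j hz').comp_add_const z _).const_mul ((-1 : ℂ) ^ j)
      exact h1.congr_deriv (by ring)) j (s := s) (r := s.re / 2)
    (M := C * (2 * (√(q * ‖s‖))⁻¹)) (half_pos hs)
    (fun z hz => by
      have := (mem_closedBall_half_re hz).1
      show 0 < z.re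
      linarith)
    (fun z hz => by
      obtain ⟨h1, h2, h3⟩ := mem_closedBall_half_re hz
      simp only [pow_zero, one_mul]
      refine (H q a z hq hcop (by linarith) ?_).trans ?_
      · calc (q : ℝ) ^ 2 * ‖z‖ ^ 2 ≤ q ^ 2 * (3 / 2 * ‖s‖) ^ 2 := by gcongr
          _ = 9 / 4 * (q ^ 2 * ‖s‖ ^ 2) := by ring
          _ ≤ 288 * z.re := by linarith
      · gcongr
        apply inv_sqrt_half_le (by positivity)
        rw [mul_div_assoc]; gcongr)
  rw [norm_mul, norm_pow, norm_neg, norm_one, one_pow, one_mul] at key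
  refine key.trans (le_of_eq ?_)
  rw [div_pow]
  field_simp

lemma hasDerivAt_inv_pow_div_cpow_half (k : ℕ) {z : ℂ} (hz : 0 < z.re) :
    HasDerivAt (fun z : ℂ => (z ^ k)⁻¹ * (1 / z ^ (1 / 2 : ℂ)))
      (-((k + 1 / 2 : ℂ) * ((z ^ (k + 1))⁻¹ * (1 / z ^ (1 / 2 : ℂ))))) z := by
  have hz0 : z ≠ 0 := by rintro rfl; simp at hz
  have hB : z ^ (1 / 2 : ℂ) ≠ 0 := by simp [Complex.cpow_eq_zero_iff, hz0]
  have h1 : HasDerivAt (fun z : ℂ => z ^ (1 / 2 : ℂ)) (1 / 2 * z ^ (1 / 2 - 1 : ℂ) * 1) z :=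
    (hasDerivAt_id z).cpow_const (Or.inl hz)
  have h2 : z ^ (1 / 2 - 1 : ℂ) = z ^ (1 / 2 : ℂ) / z := by
    rw [Complex.cpow_sub _ _ hz0, Complex.cpow_one]
  have h3 := ((hasDerivAt_pow k z).mul h1).inv (mul_ne_zero (pow_ne_zero k hz0) hB)
  refine (h3.congr_of_eventuallyEq (Eventually.of_forall fun w => ?_)).congr_deriv ?_
  · simp [mul_comm]
  · rw [h2]
    simp only [Pi.mul_apply]
    generalize z ^ (1 / 2 : ℂ) = B at hB
    rcases k with _ | k
    · simp only [Nat.cast_zero, zero_mul, pow_zero, zero_add, pow_one]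
      field_simp
    · rw [Nat.add_sub_cancel]
      push_cast
      field_simp
      ring

/-- The constant in the principal part of `theta j` at `0`. -/
noncomputable def thetaConst (j : ℕ) : ℝ := √Real.pi * ∏ i ∈ range j, ((i : ℝ) + 1 / 2)

lemma thetaConst_nonneg (j : ℕ) : 0 ≤ thetaConst j := by
  unfold thetaConst; positivity

/-- Behaviour of the theta series near `0`. -/
lemma exists_norm_theta_sub_le (j : ℕ) : ∃ C : ℝ, 0 < C ∧ ∀ s : ℂ, 0 < s.re →
    ‖s‖ ^ 2 ≤ 64 * s.re →
    ‖theta j s - thetaConst j * ((s ^ j)⁻¹ * (1 / s ^ (1 / 2 : ℂ)))‖ ≤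
      C * ((s.re ^ j)⁻¹ * ((√‖s‖)⁻¹ * (‖s‖ ^ 2 / s.re) ^ 2)) := by
  obtain ⟨C, hC, H⟩ := exists_norm_theta_zero_sub_le
  refine ⟨j.factorial * (C * (2 * (9 / 2) ^ 2)) * 2 ^ j, by positivity, fun s hs hle => ?_⟩
  have hs1 : 0 < ‖s‖ := norm_pos_iff.2 (by rintro rfl; simp at hs)
  have key := norm_chain_le (F := fun j z => (-1) ^ j *
      (theta j z - thetaConst j * ((z ^ j)⁻¹ * (1 / z ^ (1 / 2 : ℂ)))))
    isOpen_re_pos (fun j z hz => by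
      have h1 := ((hasDerivAt_theta j hz).sub ((hasDerivAt_inv_pow_div_cpow_half j hz).const_mul
        (thetaConst j : ℂ))).const_mul ((-1 : ℂ) ^ j)
      refine h1.congr_deriv ?_
      have : (thetaConst (j + 1) : ℂ) = thetaConst j * (j + 1 / 2) := by
        simp only [thetaConst, prod_range_succ]; push_cast; ring
      rw [this]
      ring) j (s := s) (r := s.re / 2)
    (M := C * ((2 * (√‖s‖)⁻¹) * (9 / 2 * (‖s‖ ^ 2 / s.re)) ^ 2)) (half_pos hs)
    (fun z hz => by
      have := (mem_closedBall_half_re hz).1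
      show 0 < z.re
      linarith)
    (fun z hz => by
      obtain ⟨h1, h2, h3⟩ := mem_closedBall_half_re hz
      have hz0 : 0 < z.re := by linarith
      have h4 : ‖z‖ ^ 2 ≤ 9 / 4 * ‖s‖ ^ 2 := by
        calc ‖z‖ ^ 2 ≤ (3 / 2 * ‖s‖) ^ 2 := by gcongr
          _ = 9 / 4 * ‖s‖ ^ 2 := by ring
      have h5 := H z hz0 (by linarith)
      simp only [thetaConst, pow_zero, one_mul, inv_one, prod_range_zero, mul_one]
      refine h5.trans ?_
      gcongr
      · exact inv_sqrt_half_le hs1 h3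
      · calc ‖z‖ ^ 2 / z.re ≤ (9 / 4 * ‖s‖ ^ 2) / (s.re / 2) := by gcongr
          _ = 9 / 2 * (‖s‖ ^ 2 / s.re) := by field_simp; ring)
  rw [norm_mul, norm_pow, norm_neg, norm_one, one_pow, one_mul] at key
  refine key.trans (le_of_eq ?_)
  rw [div_pow]
  field_simp

lemma norm_one_sub_exp_neg_ge {s : ℂ} (h0 : 0 < s.re) (h1 : s.re ≤ 1) (him : |s.im| ≤ Real.pi) :
    ‖s‖ / 4 ≤ ‖1 - Complex.exp (-s)‖ := by
  apply le_of_sq_le_sq _ (norm_nonneg _)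
  set r := Real.exp (-s.re) with hr
  have hnorm : ‖1 - Complex.exp (-s)‖ ^ 2 = (1 - r) ^ 2 + 4 * r * Real.sin (s.im / 2) ^ 2 := by
    rw [← Complex.normSq_eq_norm_sq, Complex.normSq_apply]
    have hre : (Complex.exp (-s)).re = r * Real.cos s.im := by
      rw [Complex.exp_re, Complex.neg_re, Complex.neg_im, Real.cos_neg]
    have him : (Complex.exp (-s)).im = -(r * Real.sin s.im) := by
      rw [Complex.exp_im, Complex.neg_re, Complex.neg_im, Real.sin_neg]; ring
    rw [Complex.sub_re, Complex.sub_im, hre, him, Complex.one_re, Complex.one_im]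
    have h2 : Real.cos s.im = 1 - 2 * Real.sin (s.im / 2) ^ 2 := by
      have := Real.cos_two_mul (s.im / 2)
      have h3 := Real.sin_sq_add_cos_sq (s.im / 2)
      rw [show 2 * (s.im / 2) = s.im by ring] at this
      linarith
    have h3 := Real.sin_sq_add_cos_sq s.im
    have h4 : Real.sin s.im ^ 2 = 1 - Real.cos s.im ^ 2 := by linarith
    calc _ = 1 - 2 * r * Real.cos s.im + r ^ 2 * Real.cos s.im ^ 2 + r ^ 2 * Real.sin s.im ^ 2 := by ring
      _ = 1 - 2 * r * Real.cos s.im + r ^ 2 := by rw [h4]; ring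
      _ = _ := by rw [h2]; ring
  have hr1 : r ≤ 1 - s.re / 2 := by
    have h5 := Real.quadratic_le_exp_of_nonneg h0.le
    have h6 : r * Real.exp s.re = 1 := by rw [hr, ← Real.exp_add]; simp
    have h7 : 0 < r := Real.exp_pos _
    have h8 : r * (1 + s.re + s.re ^ 2 / 2) ≤ 1 := by nlinarith
    have h9 : 0 < 1 + s.re + s.re ^ 2 / 2 := by positivity
    have h10 : 1 ≤ (1 - s.re / 2) * (1 + s.re + s.re ^ 2 / 2) := by nlinarith [mul_pos h0 h0]
    by_contra hcon
    push Not at hcon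
    nlinarith
  have hr2 : 1 / 3 ≤ r := by
    have : Real.exp (-1) ≤ r := Real.exp_le_exp.2 (by linarith)
    have h5 := Real.exp_one_lt_d9
    have h6 : Real.exp (-1) * Real.exp 1 = 1 := by rw [← Real.exp_add]; simp
    have h7 := Real.exp_pos (-1)
    nlinarith
  have hsin : (s.im / Real.pi) ^ 2 ≤ Real.sin (s.im / 2) ^ 2 := by
    rw [← sq_abs (s.im / Real.pi), ← sq_abs (Real.sin _)]
    have h5 := Real.mul_abs_le_abs_sin (x := s.im / 2) (by
      rw [abs_div, abs_two]; linarith)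
    have h6 : |s.im / Real.pi| = 2 / Real.pi * |s.im / 2| := by
      rw [abs_div, abs_div, abs_two, abs_of_pos Real.pi_pos]; ring
    rw [h6]
    gcongr
  have hpi : Real.pi ^ 2 ≤ 10 := by nlinarith [Real.pi_lt_d2, Real.pi_pos]
  have hsin2 : s.im ^ 2 / 10 ≤ Real.sin (s.im / 2) ^ 2 := by
    refine le_trans ?_ hsin
    rw [div_pow]
    gcongr
  rw [hnorm, div_pow, ← Complex.normSq_eq_norm_sq, Complex.normSq_apply]
  have h5 : (s.re / 2) ^ 2 ≤ (1 - r) ^ 2 := by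
    apply pow_le_pow_left₀ (by positivity); linarith
  have h6 : 0 ≤ Real.sin (s.im / 2) ^ 2 := by positivity
  nlinarith [sq_nonneg s.im, sq_nonneg s.re]

lemma norm_inv_one_sub_exp_sub_inv_le {s : ℂ} (h0 : 0 < s.re) (h1 : s.re ≤ 1)
    (him : |s.im| ≤ Real.pi) :
    ‖1 / (1 - Complex.exp (-s)) - 1 / s‖ ≤ 5 := by
  have hge := norm_one_sub_exp_neg_ge h0 h1 him
  have hs0 : s ≠ 0 := by rintro rfl; simp at h0
  have hs1 : 0 < ‖s‖ := norm_pos_iff.2 hs0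
  have hne : 1 - Complex.exp (-s) ≠ 0 := norm_pos_iff.1 (by linarith)
  rcases le_total ‖s‖ 1 with hs | hs
  · have h2 : 1 / (1 - Complex.exp (-s)) - 1 / s =
        (Complex.exp (-s) - 1 - (-s)) / ((1 - Complex.exp (-s)) * s) := by
      field_simp; ring
    rw [h2, norm_div, norm_mul, div_le_iff₀ (by positivity)]
    have h3 := Complex.norm_exp_sub_one_sub_id_le (x := -s) (by rwa [norm_neg])
    rw [norm_neg] at h3
    nlinarith
  · refine (norm_sub_le _ _).trans ?_
    rw [norm_div, norm_div, norm_one]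
    have h2 : 1 / ‖1 - Complex.exp (-s)‖ ≤ 4 := by
      rw [div_le_iff₀ (by linarith)]; linarith
    have h3 : 1 / ‖s‖ ≤ 1 := by rw [div_le_iff₀ hs1]; linarith
    linarith

lemma cpow_half_re_nonneg (z : ℂ) : 0 ≤ (1 / z ^ (1 / 2 : ℂ)).re := by
  rw [one_div, Complex.inv_re, show (1 / 2 : ℂ) = 2⁻¹ by norm_num, Complex.cpow_inv_two_re]
  exact div_nonneg (Real.sqrt_nonneg _) (Complex.normSq_nonneg _)

lemma one_div_cpow_half_sq (z : ℂ) : (1 / z ^ (1 / 2 : ℂ)) ^ 2 = 1 / z := by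
  rw [div_pow, one_pow, ← Complex.cpow_nat_mul]
  norm_num

lemma norm_pow_sub_pow_le {x y : ℂ} {M : ℝ} (hx : ‖x‖ ≤ M) (hy : ‖y‖ ≤ M) (k : ℕ) :
    ‖x ^ (k + 1) - y ^ (k + 1)‖ ≤ (k + 1) * M ^ k * ‖x - y‖ := by
  have hM : 0 ≤ M := (norm_nonneg _).trans hx
  induction k with
  | zero => simp
  | succ k ih =>
    have : x ^ (k + 1 + 1) - y ^ (k + 1 + 1) =
        x * (x ^ (k + 1) - y ^ (k + 1)) + (x - y) * y ^ (k + 1) := by ring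
    rw [this]
    refine (norm_add_le _ _).trans ?_
    rw [norm_mul, norm_mul, norm_pow]
    calc ‖x‖ * ‖x ^ (k + 1) - y ^ (k + 1)‖ + ‖x - y‖ * ‖y‖ ^ (k + 1)
        ≤ M * ((k + 1) * M ^ k * ‖x - y‖) + ‖x - y‖ * M ^ (k + 1) := by gcongr
      _ = _ := by push_cast; ring

/-- The square-root singularity `(1 - e^{-s})^{-1/2}` used to model the theta series at `0`. -/
noncomputable def rootSing (s : ℂ) : ℂ := 1 / (1 - Complex.exp (-s)) ^ (1 / 2 : ℂ)

lemma norm_rootSing_le {s : ℂ} (h0 : 0 < s.re) (h1 : s.re ≤ 1) (him : |s.im| ≤ Real.pi) :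
    ‖rootSing s‖ ≤ 2 * (√‖s‖)⁻¹ := by
  have hs1 : 0 < ‖s‖ := norm_pos_iff.2 (by rintro rfl; simp at h0)
  rw [rootSing, norm_one_div_cpow_half]
  have h2 := Real.sqrt_le_sqrt (norm_one_sub_exp_neg_ge h0 h1 him)
  rw [Real.sqrt_div (norm_nonneg _), show (4 : ℝ) = 2 ^ 2 by norm_num,
    Real.sqrt_sq (by norm_num)] at h2
  have h3 : 0 < √‖s‖ := Real.sqrt_pos.2 hs1
  calc _ ≤ (√‖s‖ / 2)⁻¹ := inv_anti₀ (by positivity) h2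
    _ = _ := by rw [inv_div]; rfl

lemma norm_rootSing_sub_le {s : ℂ} (h0 : 0 < s.re) (h1 : s.re ≤ 1) (him : |s.im| ≤ Real.pi) :
    ‖rootSing s - 1 / s ^ (1 / 2 : ℂ)‖ ≤ 10 * √‖s‖ := by
  have hs1 : 0 < ‖s‖ := norm_pos_iff.2 (by rintro rfl; simp at h0)
  set B := 1 / s ^ (1 / 2 : ℂ) with hB
  have hBre : 0 ≤ B.re := cpow_half_re_nonneg s
  have hrre : 0 ≤ (rootSing s).re := cpow_half_re_nonneg _
  have hBn : ‖B‖ = (√‖s‖)⁻¹ := norm_one_div_cpow_half s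
  have hB2 : B ^ 2 = 1 / s := one_div_cpow_half_sq s
  have hprod : ‖rootSing s - B‖ * ‖rootSing s + B‖ ≤ 5 := by
    rw [← norm_mul]
    have : (rootSing s - B) * (rootSing s + B) = 1 / (1 - Complex.exp (-s)) - 1 / s := by
      rw [← hB2, ← one_div_cpow_half_sq (1 - Complex.exp (-s)), rootSing]; ring
    rw [this]
    exact norm_inv_one_sub_exp_sub_inv_le h0 h1 him
  have hBsq : 0 < B.re ^ 2 - B.im ^ 2 := by
    have h2 : (B ^ 2).re = B.re ^ 2 - B.im ^ 2 := by rw [sq, Complex.mul_re]; ring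
    rw [← h2, hB2, one_div, Complex.inv_re, Complex.normSq_eq_norm_sq]
    positivity
  have hBB : ‖B‖ ≤ 2 * B.re := by
    apply le_of_sq_le_sq _ (by positivity)
    rw [← Complex.normSq_eq_norm_sq, Complex.normSq_apply]
    nlinarith
  have hsum : (√‖s‖)⁻¹ / 2 ≤ ‖rootSing s + B‖ := by
    have h2 := Complex.re_le_norm (rootSing s + B)
    rw [Complex.add_re] at h2
    rw [← hBn]
    linarith
  have h3 : 0 < √‖s‖ := Real.sqrt_pos.2 hs1
  have h4 : ‖rootSing s - B‖ * ((√‖s‖)⁻¹ / 2) ≤ 5 :=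
    (mul_le_mul_of_nonneg_left hsum (norm_nonneg _)).trans hprod
  have h5 : ‖rootSing s - B‖ = ‖rootSing s - B‖ * ((√‖s‖)⁻¹ / 2) * (2 * √‖s‖) := by
    field_simp
  rw [h5]
  nlinarith

lemma norm_rootSing_pow_sub_le (k : ℕ) {s : ℂ} (h0 : 0 < s.re) (h1 : s.re ≤ 1)
    (him : |s.im| ≤ Real.pi) :
    ‖rootSing s ^ (k + 2) - (1 / s ^ (1 / 2 : ℂ)) ^ (k + 2)‖ ≤
      (10 * (k + 2) * 2 ^ (k + 1)) * (√‖s‖)⁻¹ ^ k := by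
  have hs1 : 0 < ‖s‖ := norm_pos_iff.2 (by rintro rfl; simp at h0)
  have h3 : 0 < √‖s‖ := Real.sqrt_pos.2 hs1
  have h := norm_pow_sub_pow_le (norm_rootSing_le h0 h1 him)
    (y := 1 / s ^ (1 / 2 : ℂ)) (by
      rw [norm_one_div_cpow_half]
      have : 0 ≤ (√‖s‖)⁻¹ := by positivity
      linarith) (k + 1)
  refine h.trans ((mul_le_mul_of_nonneg_left (norm_rootSing_sub_le h0 h1 him)
    (by positivity)).trans (le_of_eq ?_))
  push_cast
  rw [mul_pow, pow_succ (√‖s‖)⁻¹]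
  field_simp
  ring

/-- The Dirichlet-type kernel `∑_{k ≤ N} e^{ks}`. -/
noncomputable def kernel (N : ℕ) (s : ℂ) : ℂ := ∑ k ∈ range (N + 1), Complex.exp (k * s)

lemma norm_kernel_le {N : ℕ} (hN : 0 < N) {s : ℂ} (hs : s.re = (N : ℝ)⁻¹)
    (him : |s.im| ≤ Real.pi) : ‖kernel N s‖ ≤ 40 * ‖s‖⁻¹ := by
  have hN1 : (1 : ℝ) ≤ N := by exact_mod_cast hN
  have h0 : 0 < s.re := by rw [hs]; positivity
  have h1 : s.re ≤ 1 := by rw [hs]; exact inv_le_one_of_one_le₀ hN1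
  have hs1 : 0 < ‖s‖ := norm_pos_iff.2 (by rintro rfl; simp at h0)
  have hge := norm_one_sub_exp_neg_ge h0 h1 him
  have hexp : ‖Complex.exp s - 1‖ = Real.exp s.re * ‖1 - Complex.exp (-s)‖ := by
    rw [← Complex.norm_exp, ← norm_mul, mul_sub, ← Complex.exp_add]; simp
  have hge2 : ‖s‖ / 4 ≤ ‖Complex.exp s - 1‖ := by
    rw [hexp]
    have : 1 ≤ Real.exp s.re := Real.one_le_exp h0.le
    nlinarith [norm_nonneg (1 - Complex.exp (-s))]
  have hgeom : kernel N s * (Complex.exp s - 1) = Complex.exp s ^ (N + 1) - 1 := by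
    rw [← geom_sum_mul]
    simp_rw [kernel, Complex.exp_nat_mul]
  have htop : ‖Complex.exp s ^ (N + 1) - 1‖ ≤ 10 := by
    refine (norm_sub_le _ _).trans ?_
    rw [← Complex.exp_nat_mul, Complex.norm_exp, norm_one]
    have h2 : ((N + 1 : ℕ) * s : ℂ).re ≤ 2 := by
      rw [← Complex.ofReal_natCast, Complex.re_ofReal_mul, hs]
      push_cast
      rw [← div_eq_mul_inv, div_le_iff₀ (by positivity)]
      linarith
    have h3 : Real.exp 2 ≤ 9 := by
      have := Real.exp_one_lt_d9
      rw [show (2 : ℝ) = 1 + 1 by norm_num, Real.exp_add]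
      nlinarith [Real.exp_pos 1]
    have := Real.exp_le_exp.2 h2
    linarith
  have h4 : ‖kernel N s‖ * ‖Complex.exp s - 1‖ ≤ 10 := by rw [← norm_mul, hgeom]; exact htop
  rw [← div_eq_mul_inv, le_div_iff₀ hs1]
  nlinarith [norm_nonneg (kernel N s)]

section

lemma norm_prod_sub_prod_le {ι : Type*} (S : Finset ι) (u w : ι → ℂ) (M : ι → ℝ) (e : ℝ)
    (hu : ∀ i ∈ S, ‖u i‖ ≤ M i) (hw : ∀ i ∈ S, ‖w i‖ ≤ M i)
    (hd : ∀ i ∈ S, ‖u i - w i‖ ≤ M i * e) :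
    ‖∏ i ∈ S, u i - ∏ i ∈ S, w i‖ ≤ #S * (∏ i ∈ S, M i) * e := by
  classical
  induction S using Finset.induction_on with
  | empty => simp
  | insert j S hj ih =>
    rw [prod_insert hj, prod_insert hj, prod_insert hj, card_insert_of_notMem hj]
    have ih' := ih (fun i hi => hu i (mem_insert_of_mem hi)) (fun i hi => hw i (mem_insert_of_mem hi))
      (fun i hi => hd i (mem_insert_of_mem hi))
    have h1 : ‖∏ i ∈ S, w i‖ ≤ ∏ i ∈ S, M i := by
      rw [norm_prod]
      exact prod_le_prod (fun _ _ => norm_nonneg _) fun i hi => hw i (mem_insert_of_mem hi)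
    have h2 := hu j (mem_insert_self j S)
    have h3 := hd j (mem_insert_self j S)
    have hM : 0 ≤ M j := (norm_nonneg _).trans h2
    rw [show u j * ∏ i ∈ S, u i - w j * ∏ i ∈ S, w i =
      u j * (∏ i ∈ S, u i - ∏ i ∈ S, w i) + (u j - w j) * ∏ i ∈ S, w i by ring]
    refine (norm_add_le _ _).trans ?_
    rw [norm_mul, norm_mul]
    refine (add_le_add (mul_le_mul h2 ih' (norm_nonneg _) hM)
      (mul_le_mul h3 h1 (norm_nonneg _) ((norm_nonneg _).trans h3))).trans (le_of_eq ?_)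
    push_cast
    ring

lemma norm_sq_eq_im_sub {Q : ℝ} {s : ℂ} (hs : s.re = (Q ^ 2)⁻¹) (x : ℝ) :
    ‖s - x * Complex.I‖ ^ 2 = (s.im - x) ^ 2 + (Q ^ 2)⁻¹ ^ 2 := by
  rw [← Complex.normSq_eq_norm_sq, Complex.normSq_apply]
  simp [hs]
  ring

lemma inv_sqrt_le_of_inv_sq_le {Q x : ℝ} (hQ : 1 ≤ Q) (hx : (Q ^ 2)⁻¹ ≤ x) : (√x)⁻¹ ≤ Q := by
  have hQ0 : 0 < Q := by linarith
  have h : Q⁻¹ ≤ √x := Real.le_sqrt_of_sq_le (by rwa [inv_pow])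
  exact (inv_le_comm₀ hQ0 (by have : 0 < Q⁻¹ := by positivity
                              linarith)).1 h

variable {k : ℕ}

lemma exists_norm_prod_theta_le (α : Fin (k + 5) → ℕ) : ∃ C > 0, ∀ (Q : ℝ) (s : ℂ), 1 ≤ Q →
    s.re = (Q ^ 2)⁻¹ → |s.im| ≤ Real.pi → ∃ (q : ℕ) (a : ℤ), 1 ≤ q ∧ (q : ℝ) ≤ Q ∧
      |a| ≤ (q : ℤ) ∧ ‖∏ i, theta (α i) s‖ ≤ C * (Q ^ (2 * ∑ i, α i + k + 1) *
        (((q : ℝ) ^ 2 * √q)⁻¹ * ((s.im - 2 * Real.pi * a / q) ^ 2 + (Q ^ 2)⁻¹ ^ 2)⁻¹)) := by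
  choose Cf hCf hth using fun j => exists_norm_theta_le j
  refine ⟨∏ i, Cf (α i), prod_pos fun i _ => hCf _, fun Q s hQ hs him => ?_⟩
  have hQ0 : 0 < Q := by linarith
  have hpi := Real.pi_pos
  obtain ⟨r, hr1, hr2⟩ := Real.exists_rat_abs_sub_le_and_den_le (s.im / (2 * Real.pi))
    (n := ⌊Q⌋₊) (Nat.floor_pos.2 hQ)
  have hq1 : 1 ≤ r.den := r.den_pos
  have hq1' : (1 : ℝ) ≤ r.den := by exact_mod_cast hq1
  have hqQ : (r.den : ℝ) ≤ Q := (Nat.cast_le.2 hr2).trans (Nat.floor_le hQ0.le)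
  have hrr : (r : ℝ) = r.num / r.den := by exact_mod_cast (Rat.num_div_den r).symm
  have hfl : Q ≤ (⌊Q⌋₊ : ℝ) + 1 := (Nat.lt_floor_add_one Q).le
  have hdist : |s.im - 2 * Real.pi * r.num / r.den| ≤ 2 * Real.pi / (Q * r.den) := by
    have e : s.im - 2 * Real.pi * r.num / r.den = 2 * Real.pi * (s.im / (2 * Real.pi) - r) := by
      rw [hrr]; field_simp
    rw [e, abs_mul, abs_of_pos (by positivity : 0 < 2 * Real.pi)]
    have : 1 / (((⌊Q⌋₊ : ℝ) + 1) * r.den) ≤ 1 / (Q * r.den) :=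
      one_div_le_one_div_of_le (by positivity) (by gcongr)
    calc _ ≤ 2 * Real.pi * (1 / (Q * r.den)) := by gcongr; exact hr1.trans this
      _ = _ := by ring
  refine ⟨r.den, r.num, hq1, hqQ, ?_, ?_⟩
  · have h1 : |(r : ℝ)| ≤ 1 / 2 + 1 / (((⌊Q⌋₊ : ℝ) + 1) * r.den) := by
      have h2 : |s.im / (2 * Real.pi)| ≤ 1 / 2 := by
        rw [abs_div, abs_of_pos (by positivity : 0 < 2 * Real.pi), div_le_iff₀ (by positivity)]
        linarith
      have h3 := abs_sub_abs_le_abs_sub (r : ℝ) (s.im / (2 * Real.pi))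
      rw [abs_sub_comm] at h3
      linarith
    have h4 : 1 / (((⌊Q⌋₊ : ℝ) + 1) * r.den) ≤ 1 / 2 := by
      apply one_div_le_one_div_of_le (by norm_num)
      have : (1 : ℝ) ≤ ⌊Q⌋₊ := by exact_mod_cast Nat.floor_pos.2 hQ
      nlinarith
    have h5 : |(r.num : ℝ)| ≤ r.den := by
      have : |(r : ℝ)| ≤ 1 := by linarith
      rw [hrr, abs_div, Nat.abs_cast, div_le_one (by positivity)] at this
      exact this
    exact_mod_cast h5
  · set x : ℝ := 2 * Real.pi * r.num / r.den with hx
    set w : ℂ := s - x * Complex.I with hw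
    have hwre : w.re = (Q ^ 2)⁻¹ := by simp [hw, hs]
    have hwn := norm_sq_eq_im_sub hs x
    rw [← hw] at hwn
    have hwre0 : 0 < w.re := by rw [hwre]; positivity
    have hsw : s = w + 2 * Real.pi * Complex.I * (r.num : ℤ) / (r.den : ℕ) := by
      rw [hw, hx]; push_cast; ring
    have hcop : IsCoprime r.num (r.den : ℤ) := by
      rw [Int.isCoprime_iff_gcd_eq_one]; exact r.reduced
    have hbd : (r.den : ℝ) ^ 2 * ‖w‖ ^ 2 ≤ 64 * w.re := by
      rw [hwn, hwre]
      have h1 : (s.im - x) ^ 2 ≤ (2 * Real.pi / (Q * r.den)) ^ 2 := sq_le_sq' (by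
        linarith [neg_abs_le (s.im - x)]) ((le_abs_self _).trans hdist)
      have h2 : (r.den : ℝ) ^ 2 * (2 * Real.pi / (Q * r.den)) ^ 2 = 4 * Real.pi ^ 2 * (Q ^ 2)⁻¹ := by
        field_simp; ring
      have h3 : (r.den : ℝ) ^ 2 * (Q ^ 2)⁻¹ ^ 2 ≤ (Q ^ 2)⁻¹ := by
        have : (r.den : ℝ) ^ 2 * (Q ^ 2)⁻¹ ≤ 1 := by
          rw [← div_eq_mul_inv, div_le_one (by positivity)]; gcongr
        calc _ = ((r.den : ℝ) ^ 2 * (Q ^ 2)⁻¹) * (Q ^ 2)⁻¹ := by ring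
          _ ≤ 1 * (Q ^ 2)⁻¹ := by gcongr
          _ = _ := one_mul _
      have h4 : Real.pi ^ 2 ≤ 10 := by nlinarith [Real.pi_lt_d2]
      have h5 : 0 < (Q ^ 2)⁻¹ := by positivity
      calc _ = (r.den : ℝ) ^ 2 * (s.im - x) ^ 2 + (r.den : ℝ) ^ 2 * (Q ^ 2)⁻¹ ^ 2 := by ring
        _ ≤ (r.den : ℝ) ^ 2 * (2 * Real.pi / (Q * r.den)) ^ 2 + (Q ^ 2)⁻¹ := by gcongr
        _ ≤ _ := by rw [h2]; nlinarith
    have hwp : (Q ^ 2)⁻¹ ≤ ‖w‖ := hwre ▸ Complex.re_le_norm w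
    have hw0 : 0 < ‖w‖ := lt_of_lt_of_le (by positivity) hwp
    have hu : (√(r.den * ‖w‖))⁻¹ ≤ Q := inv_sqrt_le_of_inv_sq_le hQ (hwp.trans (by nlinarith))
    have hu' : (√‖w‖)⁻¹ ≤ Q := inv_sqrt_le_of_inv_sq_le hQ hwp
    have hsq : √‖w‖ ^ 2 = ‖w‖ := Real.sq_sqrt hw0.le
    have hsq' : √(r.den : ℝ) ^ 2 = r.den := Real.sq_sqrt (by positivity)
    have hsw0 : 0 < √‖w‖ := Real.sqrt_pos.2 hw0
    have hsq0 : 0 < √(r.den : ℝ) := Real.sqrt_pos.2 (by positivity)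
    rw [norm_prod, ← hwn]
    calc ∏ i, ‖theta (α i) s‖ ≤ ∏ i, Cf (α i) * (Q ^ (2 * α i) * (√(r.den * ‖w‖))⁻¹) := by
          refine prod_le_prod (fun _ _ => norm_nonneg _) fun i _ => ?_
          rw [hsw]
          refine (hth (α i) r.den r.num w r.den_pos hcop hwre0 hbd).trans (le_of_eq ?_)
          rw [hwre, inv_pow, inv_inv, ← pow_mul]
      _ = (∏ i, Cf (α i)) * (Q ^ (2 * ∑ i, α i) *
            ((√(r.den * ‖w‖))⁻¹ ^ k * (√(r.den * ‖w‖))⁻¹ ^ 5)) := by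
          rw [prod_mul_distrib, prod_mul_distrib, prod_pow_eq_pow_sum, ← mul_sum, prod_const,
            card_univ, Fintype.card_fin, pow_add _ k 5]
      _ ≤ (∏ i, Cf (α i)) * (Q ^ (2 * ∑ i, α i) *
            (Q ^ k * (((r.den : ℝ) ^ 2 * √r.den)⁻¹ * (‖w‖ ^ 2)⁻¹ * Q))) := by
          have hP : 0 ≤ ∏ i, Cf (α i) := prod_nonneg fun i _ => (hCf _).le
          have h5 : (√(r.den * ‖w‖))⁻¹ ^ 5 ≤ ((r.den : ℝ) ^ 2 * √r.den)⁻¹ * (‖w‖ ^ 2)⁻¹ * Q := by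
            calc (√(r.den * ‖w‖))⁻¹ ^ 5
                = ((r.den : ℝ) ^ 2 * √r.den)⁻¹ * (‖w‖ ^ 2)⁻¹ * (√‖w‖)⁻¹ := by
                  rw [Real.sqrt_mul (by positivity)]
                  nth_rw 2 [← hsq']; nth_rw 2 [← hsq]
                  rw [← mul_inv, ← mul_inv, inv_pow]
                  congr 1; ring
              _ ≤ _ := by gcongr
          gcongr
      _ = _ := by ring

lemma exists_norm_prod_theta_sub_le (α : Fin (k + 5) → ℕ) : ∃ C > 0, ∀ (Q : ℝ) (s : ℂ), 1 ≤ Q →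
    s.re = (Q ^ 2)⁻¹ → |s.im| ≤ Q⁻¹ →
      ‖∏ i, theta (α i) s - (∏ i, (thetaConst (α i) : ℂ)) *
        (1 / s ^ (1 / 2 : ℂ)) ^ (2 * ∑ i, α i + k + 5)‖ ≤
      C * (Q ^ (2 * ∑ i, α i + k + 4) * ‖s‖) := by
  choose Cf hCf hth using fun j => exists_norm_theta_le j
  choose Cd hCd hdf using fun j => exists_norm_theta_sub_le j
  refine ⟨2 * (k + 5) * ∏ i, (Cf (α i) + thetaConst (α i) + Cd (α i)), ?_,
    fun Q s hQ hs him => ?_⟩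
  · have : 0 < ∏ i, (Cf (α i) + thetaConst (α i) + Cd (α i)) :=
      prod_pos fun i _ => by linarith [hCf (α i), hCd (α i), thetaConst_nonneg (α i)]
    positivity
  have hQ0 : 0 < Q := by linarith
  have hre : 0 < s.re := by rw [hs]; positivity
  have hn2 : ‖s‖ ^ 2 ≤ 2 * (Q ^ 2)⁻¹ := by
    have h := norm_sq_eq_im_sub hs 0
    simp only [Complex.ofReal_zero, zero_mul, sub_zero] at h
    have h1 : s.im ^ 2 ≤ (Q ^ 2)⁻¹ := by rw [← sq_abs, ← inv_pow]; gcongr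
    have h2 : (Q ^ 2)⁻¹ ≤ 1 := inv_le_one_of_one_le₀ (one_le_pow₀ hQ)
    have h3 : 0 < (Q ^ 2)⁻¹ := by positivity
    nlinarith
  have h64 : ‖s‖ ^ 2 ≤ 64 * s.re := by rw [hs]; have : 0 < (Q ^ 2)⁻¹ := by positivity
                                       linarith
  have hsp : (Q ^ 2)⁻¹ ≤ ‖s‖ := hs ▸ Complex.re_le_norm s
  have hs0 : 0 < ‖s‖ := lt_of_lt_of_le (by positivity) hsp
  have hv : (√‖s‖)⁻¹ ≤ Q := inv_sqrt_le_of_inv_sq_le hQ hsp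
  have hv0 : 0 < √‖s‖ := Real.sqrt_pos.2 hs0
  have hsq : √‖s‖ ^ 2 = ‖s‖ := Real.sq_sqrt hs0.le
  set M : Fin (k + 5) → ℝ := fun i => (Cf (α i) + thetaConst (α i) + Cd (α i)) *
    (Q ^ (2 * α i) * (√‖s‖)⁻¹) with hM
  have hprod : (∏ i, (thetaConst (α i) : ℂ)) * (1 / s ^ (1 / 2 : ℂ)) ^ (2 * ∑ i, α i + k + 5) =
      ∏ i, (thetaConst (α i) * ((s ^ α i)⁻¹ * (1 / s ^ (1 / 2 : ℂ)))) := by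
    rw [prod_mul_distrib, prod_mul_distrib, prod_const, card_univ, Fintype.card_fin, add_assoc,
      pow_add _ (2 * _), pow_mul, one_div_cpow_half_sq]
    congr 2
    simp_rw [one_div, ← inv_pow]
    rw [prod_pow_eq_pow_sum]
  have hre' : ∀ j : ℕ, (s.re ^ j)⁻¹ = Q ^ (2 * j) := fun j => by
    rw [hs, inv_pow, inv_inv, ← pow_mul]
  have key := norm_prod_sub_prod_le univ (fun i => theta (α i) s)
    (fun i => (thetaConst (α i) * ((s ^ α i)⁻¹ * (1 / s ^ (1 / 2 : ℂ))) : ℂ)) M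
    ((‖s‖ ^ 2 * Q ^ 2) ^ 2) ?_ ?_ ?_
  · rw [hprod]
    refine key.trans ?_
    rw [card_univ, Fintype.card_fin, hM, prod_mul_distrib, prod_mul_distrib, prod_const, card_univ,
      Fintype.card_fin, prod_pow_eq_pow_sum, ← mul_sum]
    have hP : 0 < ∏ i, (Cf (α i) + thetaConst (α i) + Cd (α i)) :=
      prod_pos fun i _ => by linarith [hCf (α i), hCd (α i), thetaConst_nonneg (α i)]
    have hle : (√‖s‖)⁻¹ ^ (k + 5) * (‖s‖ ^ 2 * Q ^ 2) ^ 2 ≤ Q ^ (k + 4) * (2 * ‖s‖) := by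
      have h1 : (√‖s‖)⁻¹ ^ 5 * (‖s‖ ^ 2) ^ 2 = ‖s‖ * √‖s‖ := by
        nth_rw 2 3 [← hsq]
        field_simp
      have h2 : √‖s‖ ≤ 2 := by
        rw [Real.sqrt_le_left (by norm_num)]
        have h2 : (Q ^ 2)⁻¹ ≤ 1 := inv_le_one_of_one_le₀ (one_le_pow₀ hQ)
        nlinarith
      calc _ = (√‖s‖)⁻¹ ^ k * Q ^ 4 * ((√‖s‖)⁻¹ ^ 5 * (‖s‖ ^ 2) ^ 2) := by ring
        _ = (√‖s‖)⁻¹ ^ k * Q ^ 4 * (‖s‖ * √‖s‖) := by rw [h1]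
        _ ≤ Q ^ k * Q ^ 4 * (‖s‖ * 2) := by gcongr
        _ = _ := by ring
    calc _ = (k + 5 : ℝ) * (∏ i, (Cf (α i) + thetaConst (α i) + Cd (α i))) * Q ^ (2 * ∑ i, α i) *
          ((√‖s‖)⁻¹ ^ (k + 5) * (‖s‖ ^ 2 * Q ^ 2) ^ 2) := by push_cast; ring
      _ ≤ (k + 5 : ℝ) * (∏ i, (Cf (α i) + thetaConst (α i) + Cd (α i))) * Q ^ (2 * ∑ i, α i) *
          (Q ^ (k + 4) * (2 * ‖s‖)) := by gcongr
      _ = _ := by ring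
  · intro i _
    have h := hth (α i) 1 0 s one_pos isCoprime_one_right hre (by simpa using h64)
    simp only [Int.cast_zero, mul_zero, zero_div, add_zero, Nat.cast_one, one_mul, hre'] at h
    refine h.trans ?_
    simp only [hM]
    have h1 := hCd (α i)
    have h2 := thetaConst_nonneg (α i)
    gcongr
    linarith
  · intro i _
    rw [norm_mul, norm_mul, norm_one_div_cpow_half, norm_inv, norm_pow, Complex.norm_real,
      Real.norm_of_nonneg (thetaConst_nonneg _)]
    have h1 : (‖s‖ ^ α i)⁻¹ ≤ Q ^ (2 * α i) := by
      rw [← hre', hs]; gcongr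
    have h2 := hCd (α i)
    have h3 := thetaConst_nonneg (α i)
    have h4 := hCf (α i)
    simp only [hM]
    gcongr
    linarith
  · intro i _
    have h := hdf (α i) s hre h64
    refine h.trans ?_
    simp only [hM]
    rw [hre', hs, div_inv_eq_mul]
    have h2 := hCf (α i)
    have h3 := thetaConst_nonneg (α i)
    rw [← mul_assoc (Q ^ (2 * α i)), ← mul_assoc]
    gcongr
    linarith

end

section

/-- The contribution of the arc around `2πa/q` to the majorant. -/
noncomputable def arcBound (Q : ℝ) (q : ℕ) (a : ℤ) (t : ℝ) : ℝ :=
  ((q : ℝ) ^ 2 * √q)⁻¹ * (q / |(a : ℝ)| * ((t - 2 * Real.pi * a / q) ^ 2 + (Q ^ 2)⁻¹ ^ 2)⁻¹ +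
    Q * (q ^ 2 / |(a : ℝ)| ^ 2))

/-- A majorant, integrable on the circle, of the error term in the contour integral. -/
noncomputable def arcMajorant (Q t : ℝ) : ℝ :=
  Q * (t ^ 2 + Q⁻¹ ^ 2)⁻¹ + (t ^ 2 + (Q ^ 2)⁻¹ ^ 2)⁻¹ +
    ∑ q ∈ Icc 1 ⌊Q⌋₊, ∑ a ∈ Icc (-(q : ℤ)) q, arcBound Q q a t

lemma arcBound_nonneg {Q : ℝ} (hQ : 0 ≤ Q) (q : ℕ) (a : ℤ) (t : ℝ) : 0 ≤ arcBound Q q a t := by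
  unfold arcBound; positivity

lemma arcBound_le_arcMajorant {Q : ℝ} (hQ : 0 ≤ Q) {q : ℕ} {a : ℤ} (h1 : 1 ≤ q) (hq : (q : ℝ) ≤ Q)
    (ha : |a| ≤ q) (t : ℝ) : arcBound Q q a t ≤ arcMajorant Q t := by
  have h2 := single_le_sum (f := fun q : ℕ => ∑ a ∈ Icc (-(q : ℤ)) q, arcBound Q q a t)
    (fun i _ => sum_nonneg fun j _ => arcBound_nonneg hQ i j t)
    (mem_Icc.2 ⟨h1, Nat.le_floor hq⟩)
  have h3 := single_le_sum (f := fun a : ℤ => arcBound Q q a t)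
    (fun j _ => arcBound_nonneg hQ q j t) (mem_Icc.2 (abs_le.1 ha))
  have h4 : 0 ≤ Q * (t ^ 2 + Q⁻¹ ^ 2)⁻¹ + (t ^ 2 + (Q ^ 2)⁻¹ ^ 2)⁻¹ := by positivity
  unfold arcMajorant
  linarith

lemma le_arcMajorant {Q : ℝ} (hQ : 0 ≤ Q) (t : ℝ) :
    Q * (t ^ 2 + Q⁻¹ ^ 2)⁻¹ + (t ^ 2 + (Q ^ 2)⁻¹ ^ 2)⁻¹ ≤ arcMajorant Q t :=
  le_add_of_nonneg_right (sum_nonneg fun q _ => sum_nonneg fun a _ => arcBound_nonneg hQ q a t)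

lemma inv_abs_pow_three_le {Q t : ℝ} (hQ : 1 ≤ Q) (ht : Q⁻¹ ≤ |t|) :
    |t|⁻¹ ^ 3 ≤ 2 * (Q * (t ^ 2 + Q⁻¹ ^ 2)⁻¹) := by
  have hQ0 : 0 < Q⁻¹ := by positivity
  have h0 : 0 < |t| := hQ0.trans_le ht
  have h1 : |t|⁻¹ ≤ Q := (inv_le_comm₀ (by positivity) h0).1 ht
  have h2 : t ^ 2 + Q⁻¹ ^ 2 ≤ 2 * |t| ^ 2 := by
    rw [← sq_abs t]
    nlinarith
  have h3 : |t|⁻¹ ^ 2 ≤ 2 * (t ^ 2 + Q⁻¹ ^ 2)⁻¹ := by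
    rw [inv_pow, inv_le_comm₀ (by positivity) (by positivity), mul_inv, inv_inv]
    linarith
  calc _ = |t|⁻¹ * |t|⁻¹ ^ 2 := by ring
    _ ≤ Q * (2 * (t ^ 2 + Q⁻¹ ^ 2)⁻¹) := by gcongr
    _ = _ := by ring

lemma arc_mul_inv_abs_le {Q t : ℝ} (hQ : 1 ≤ Q) (ht : Q⁻¹ ≤ |t|) {q : ℕ} {a : ℤ} (h1 : 1 ≤ q)
    (hq : (q : ℝ) ≤ Q) (ha : |a| ≤ (q : ℤ)) :
    (((q : ℝ) ^ 2 * √q)⁻¹ * ((t - 2 * Real.pi * a / q) ^ 2 + (Q ^ 2)⁻¹ ^ 2)⁻¹) * |t|⁻¹ ≤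
      2 * arcMajorant Q t := by
  have hQ0 : 0 < Q := by linarith
  have hQi : 0 < Q⁻¹ := by positivity
  have h0 : 0 < |t| := hQi.trans_le ht
  have hinv : |t|⁻¹ ≤ Q := (inv_le_comm₀ (by positivity) h0).1 ht
  have hq1 : (1 : ℝ) ≤ q := by exact_mod_cast h1
  have hpi := Real.pi_gt_three
  rcases eq_or_ne a 0 with rfl | ha0
  · refine le_trans ?_ (mul_le_mul_of_nonneg_left (le_arcMajorant hQ0.le t) (by norm_num))
    have h2 : ((q : ℝ) ^ 2 * √q)⁻¹ ≤ 1 := inv_le_one_of_one_le₀ (by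
      have : 1 ≤ √(q : ℝ) := Real.one_le_sqrt.2 hq1
      nlinarith)
    have h3 : ((t - 2 * Real.pi * (0 : ℤ) / q) ^ 2 + (Q ^ 2)⁻¹ ^ 2)⁻¹ ≤ |t|⁻¹ ^ 2 := by
      rw [inv_pow |t|, sq_abs]
      have : 0 < t ^ 2 := by rw [← sq_abs]; positivity
      apply inv_anti₀ this
      simp
      positivity
    have h4 := inv_abs_pow_three_le hQ ht
    have h5 : 0 ≤ (t ^ 2 + (Q ^ 2)⁻¹ ^ 2)⁻¹ := by positivity
    calc _ ≤ 1 * |t|⁻¹ ^ 2 * |t|⁻¹ := by gcongr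
      _ = |t|⁻¹ ^ 3 := by ring
      _ ≤ _ := by linarith
  · have haa : 0 < |(a : ℝ)| := abs_pos.2 (by exact_mod_cast ha0)
    have hb := arcBound_le_arcMajorant hQ0.le h1 hq ha t
    have hb0 := arcBound_nonneg hQ0.le q a t
    refine le_trans ?_ (hb.trans (by linarith))
    rw [arcBound, mul_assoc]
    refine mul_le_mul_of_nonneg_left ?_ (by positivity)
    set x := 2 * Real.pi * a / q with hx
    have hxa : |x| = 2 * Real.pi * |(a : ℝ)| / q := by
      rw [hx, abs_div, abs_mul, abs_of_pos (by positivity : 0 < 2 * Real.pi), Nat.abs_cast]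
    by_cases hc : |(a : ℝ)| / q ≤ |t|
    · have h2 : |t|⁻¹ ≤ q / |(a : ℝ)| := by
        rw [← inv_div]; exact inv_anti₀ (by positivity) hc
      have h3 : 0 ≤ Q * ((q : ℝ) ^ 2 / |(a : ℝ)| ^ 2) := by positivity
      calc _ ≤ ((t - x) ^ 2 + (Q ^ 2)⁻¹ ^ 2)⁻¹ * (q / |(a : ℝ)|) := by gcongr
        _ ≤ _ := by linarith
    · push Not at hc
      have h2 : |(a : ℝ)| / q ≤ |t - x| := by
        have h3 := abs_sub_abs_le_abs_sub x t
        rw [abs_sub_comm x t] at h3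
        have h4 : 2 * (|(a : ℝ)| / q) ≤ |x| := by
          rw [hxa, mul_div_assoc]
          gcongr; linarith
        linarith
      have h3 : ((t - x) ^ 2 + (Q ^ 2)⁻¹ ^ 2)⁻¹ ≤ (q : ℝ) ^ 2 / |(a : ℝ)| ^ 2 := by
        rw [← div_pow, ← inv_div, inv_pow (|(a : ℝ)| / q)]
        apply inv_anti₀ (by positivity)
        have : (|(a : ℝ)| / q) ^ 2 ≤ |t - x| ^ 2 := by gcongr
        rw [sq_abs] at this
        have : 0 ≤ (Q ^ 2)⁻¹ ^ 2 := by positivity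
        linarith
      have h4 : 0 ≤ q / |(a : ℝ)| * ((t - x) ^ 2 + (Q ^ 2)⁻¹ ^ 2)⁻¹ := by positivity
      calc _ ≤ ((q : ℝ) ^ 2 / |(a : ℝ)| ^ 2) * Q := by gcongr
        _ ≤ _ := by linarith

variable {k : ℕ}

set_option maxHeartbeats 800000 in
lemma exists_norm_error_mul_kernel_le (α : Fin (k + 5) → ℕ) : ∃ C > 0, ∀ (N : ℕ) (Q : ℝ) (s : ℂ),
    0 < N → 0 < Q → Q ^ 2 = N → s.re = (N : ℝ)⁻¹ → |s.im| ≤ Real.pi →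
    ‖(∏ i, theta (α i) s - (∏ i, (thetaConst (α i) : ℂ)) *
        rootSing s ^ (2 * ∑ i, α i + k + 5)) * kernel N s‖ ≤
      C * (Q ^ (2 * ∑ i, α i + k + 1) * arcMajorant Q s.im) := by
  obtain ⟨C₁, hC₁, hfar⟩ := exists_norm_prod_theta_le α
  obtain ⟨C₂, hC₂, hnear⟩ := exists_norm_prod_theta_sub_le α
  set κ : ℝ := ∏ i, thetaConst (α i) with hκ
  have hκ0 : 0 ≤ κ := prod_nonneg fun i _ => thetaConst_nonneg _
  have hκc : ∏ i, (thetaConst (α i) : ℂ) = (κ : ℂ) := by rw [hκ]; push_cast; rfl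
  set m := 2 * ∑ i, α i + k + 3 with hm
  set D : ℝ := 10 * ((m : ℝ) + 2) * 2 ^ (m + 1) with hD
  have hD0 : 0 < D := by positivity
  refine ⟨80 * C₁ + 80 * C₂ + 40 * κ * D + 80 * κ * 2 ^ (m + 2), by positivity,
    fun N Q s hN hQ0 hQN hs him => ?_⟩
  have hN1 : (1 : ℝ) ≤ N := by exact_mod_cast hN
  have hQ : 1 ≤ Q := by nlinarith
  have h0 : 0 < s.re := by rw [hs]; positivity
  have h1 : s.re ≤ 1 := by rw [hs]; exact inv_le_one_of_one_le₀ hN1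
  have hker := norm_kernel_le hN hs him
  rw [← hQN] at hs
  have hsp : (Q ^ 2)⁻¹ ≤ ‖s‖ := hs ▸ Complex.re_le_norm s
  have hs0 : 0 < ‖s‖ := lt_of_lt_of_le (by positivity) hsp
  have hv : (√‖s‖)⁻¹ ≤ Q := inv_sqrt_le_of_inv_sq_le hQ hsp
  have hv0 : 0 < √‖s‖ := Real.sqrt_pos.2 hs0
  have hsq : √‖s‖ ^ 2 = ‖s‖ := Real.sq_sqrt hs0.le
  have hn := norm_sq_eq_im_sub hs 0
  simp only [Complex.ofReal_zero, zero_mul, sub_zero] at hn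
  have hM := le_arcMajorant hQ0.le s.im
  have hMp : 0 ≤ arcMajorant Q s.im := le_trans (by positivity) hM
  have hv4 : (√‖s‖)⁻¹ ^ (m + 2) ≤ Q ^ (2 * ∑ i, α i + k + 1) * (‖s‖ ^ 2)⁻¹ := by
    rw [show m + 2 = (2 * ∑ i, α i + k + 1) + 4 by omega, pow_add]
    rw [show (√‖s‖)⁻¹ ^ 4 = (‖s‖ ^ 2)⁻¹ by nth_rw 2 [← hsq]; rw [inv_pow]; ring]
    gcongr
  rw [hκc, show 2 * ∑ i, α i + k + 5 = m + 2 by omega]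
  rw [hκc, show 2 * ∑ i, α i + k + 5 = m + 2 by omega] at hnear
  set E := Q ^ (2 * ∑ i, α i + k + 1) with hE
  have hE0 : 0 < E := by positivity
  rw [norm_mul]
  rcases le_total |s.im| Q⁻¹ with hc | hc
  · have e1 := hnear Q s hQ hs hc
    have e2 := norm_rootSing_pow_sub_le m h0 h1 him
    rw [← hD] at e2
    have e3 : ‖∏ i, theta (α i) s - κ * rootSing s ^ (m + 2)‖ ≤
        C₂ * (Q ^ (2 * ∑ i, α i + k + 4) * ‖s‖) + κ * (D * (√‖s‖)⁻¹ ^ m) := by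
      rw [show ∏ i, theta (α i) s - κ * rootSing s ^ (m + 2) =
        (∏ i, theta (α i) s - κ * (1 / s ^ (1 / 2 : ℂ)) ^ (m + 2)) -
          κ * (rootSing s ^ (m + 2) - (1 / s ^ (1 / 2 : ℂ)) ^ (m + 2)) by ring]
      refine (norm_sub_le _ _).trans (add_le_add e1 ?_)
      rw [norm_mul, Complex.norm_real, Real.norm_of_nonneg hκ0]
      gcongr
    have e4 : Q ^ 3 ≤ 2 * (Q * (s.im ^ 2 + Q⁻¹ ^ 2)⁻¹) := by
      have h2 : s.im ^ 2 ≤ Q⁻¹ ^ 2 := by rw [← sq_abs]; gcongr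
      have h3 : (2 * Q⁻¹ ^ 2)⁻¹ ≤ (s.im ^ 2 + Q⁻¹ ^ 2)⁻¹ := by
        apply inv_anti₀ (by positivity); linarith
      have h4 : (2 * Q⁻¹ ^ 2)⁻¹ = Q ^ 2 / 2 := by field_simp
      rw [h4] at h3
      nlinarith
    have e5 : (√‖s‖)⁻¹ ^ m * ‖s‖⁻¹ = (√‖s‖)⁻¹ ^ (m + 2) := by
      rw [pow_add _ m 2, inv_pow _ 2, hsq]
    have e6 : 0 ≤ Q * (s.im ^ 2 + Q⁻¹ ^ 2)⁻¹ := by positivity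
    have e7 : 0 ≤ (s.im ^ 2 + (Q ^ 2)⁻¹ ^ 2)⁻¹ := by positivity
    calc _ ≤ (C₂ * (Q ^ (2 * ∑ i, α i + k + 4) * ‖s‖) + κ * (D * (√‖s‖)⁻¹ ^ m)) *
          (40 * ‖s‖⁻¹) := by gcongr
      _ = 40 * C₂ * (E * Q ^ 3) + 40 * κ * D * ((√‖s‖)⁻¹ ^ m * ‖s‖⁻¹) := by
          rw [hE, show 2 * ∑ i, α i + k + 4 = (2 * ∑ i, α i + k + 1) + 3 by omega, pow_add]
          field_simp
      _ ≤ 40 * C₂ * (E * (2 * arcMajorant Q s.im)) + 40 * κ * D * (E * arcMajorant Q s.im) := by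
          rw [e5]
          gcongr
          · linarith
          · refine hv4.trans ?_
            rw [hn]
            gcongr
            linarith
      _ = (80 * C₂ + 40 * κ * D) * (E * arcMajorant Q s.im) := by ring
      _ ≤ _ := by
          refine mul_le_mul_of_nonneg_right ?_ (by positivity)
          have : 0 ≤ 80 * κ * 2 ^ (m + 2) := by positivity
          linarith
  · obtain ⟨q, a, hq1, hqQ, haq, hf⟩ := hfar Q s hQ hs him
    have ht0 : 0 < |s.im| := lt_of_lt_of_le (by positivity) hc
    have hts : |s.im| ≤ ‖s‖ := Complex.abs_im_le_norm s
    have hti : ‖s‖⁻¹ ≤ |s.im|⁻¹ := inv_anti₀ ht0 hts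
    have e1 := arc_mul_inv_abs_le hQ hc hq1 hqQ haq
    have e2 : ‖(κ : ℂ) * rootSing s ^ (m + 2)‖ ≤ κ * (2 ^ (m + 2) * (E * |s.im|⁻¹ ^ 2)) := by
      rw [norm_mul, Complex.norm_real, Real.norm_of_nonneg hκ0, norm_pow]
      gcongr
      calc _ ≤ (2 * (√‖s‖)⁻¹) ^ (m + 2) := by gcongr; exact norm_rootSing_le h0 h1 him
        _ = 2 ^ (m + 2) * (√‖s‖)⁻¹ ^ (m + 2) := mul_pow _ _ _
        _ ≤ 2 ^ (m + 2) * (E * (‖s‖ ^ 2)⁻¹) := by gcongr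
        _ ≤ _ := by rw [← inv_pow]; gcongr
    have e3 := inv_abs_pow_three_le hQ hc
    have e7 : 0 ≤ (s.im ^ 2 + (Q ^ 2)⁻¹ ^ 2)⁻¹ := by positivity
    set R := ((q : ℝ) ^ 2 * √q)⁻¹ * ((s.im - 2 * Real.pi * a / q) ^ 2 + (Q ^ 2)⁻¹ ^ 2)⁻¹ with hR
    have hR0 : 0 ≤ R := by positivity
    calc _ ≤ (C₁ * (E * R) + κ * (2 ^ (m + 2) * (E * |s.im|⁻¹ ^ 2))) * (40 * |s.im|⁻¹) := by
          gcongr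
          · exact (norm_sub_le _ _).trans (add_le_add hf e2)
          · exact hker.trans (by gcongr)
      _ = 40 * C₁ * (E * (R * |s.im|⁻¹)) + 40 * κ * 2 ^ (m + 2) * (E * |s.im|⁻¹ ^ 3) := by ring
      _ ≤ 40 * C₁ * (E * (2 * arcMajorant Q s.im)) +
          40 * κ * 2 ^ (m + 2) * (E * (2 * arcMajorant Q s.im)) := by
          have e8 : R * |s.im|⁻¹ ≤ 2 * arcMajorant Q s.im := e1
          have e9 : |s.im|⁻¹ ^ 3 ≤ 2 * arcMajorant Q s.im := by linarith
          gcongr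
      _ = (80 * C₁ + 80 * κ * 2 ^ (m + 2)) * (E * arcMajorant Q s.im) := by ring
      _ ≤ _ := by
          refine mul_le_mul_of_nonneg_right ?_ (by positivity)
          have : 0 ≤ 80 * C₂ + 40 * κ * D := by positivity
          linarith

end

lemma continuous_inv_sq_add_sq (x : ℝ) {c : ℝ} (hc : 0 < c) :
    Continuous fun t : ℝ => ((t - x) ^ 2 + c ^ 2)⁻¹ :=
  Continuous.inv₀ (by fun_prop) fun t => by positivity

lemma integral_inv_sq_add_sq_le (x : ℝ) {c : ℝ} (hc : 0 < c) (a b : ℝ) :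
    ∫ t in a..b, ((t - x) ^ 2 + c ^ 2)⁻¹ ≤ Real.pi / c := by
  have h1 : ∀ t : ℝ, ((t - x) ^ 2 + c ^ 2)⁻¹ = (c ^ 2)⁻¹ * (1 + (t / c - x / c) ^ 2)⁻¹ := fun t => by
    field_simp; ring
  simp_rw [h1]
  rw [intervalIntegral.integral_const_mul,
    intervalIntegral.integral_comp_div_sub (fun u => (1 + u ^ 2)⁻¹) hc.ne',
    integral_inv_one_add_sq, smul_eq_mul]
  have h2 := Real.arctan_lt_pi_div_two (b / c - x / c)
  have h3 := Real.neg_pi_div_two_lt_arctan (a / c - x / c)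
  calc _ ≤ (c ^ 2)⁻¹ * (c * Real.pi) := by gcongr; linarith
    _ = _ := by field_simp

lemma continuous_arcBound {Q : ℝ} (hQ : 0 < Q) (q : ℕ) (a : ℤ) : Continuous (arcBound Q q a) := by
  have := continuous_inv_sq_add_sq (2 * Real.pi * a / q) (c := (Q ^ 2)⁻¹) (by positivity)
  unfold arcBound
  fun_prop

lemma continuous_arcMajorant {Q : ℝ} (hQ : 0 < Q) : Continuous (arcMajorant Q) := by
  have h1 := continuous_inv_sq_add_sq 0 (c := (Q ^ 2)⁻¹) (by positivity)
  have h2 := continuous_inv_sq_add_sq 0 (c := Q⁻¹) (by positivity)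
  simp only [sub_zero] at h1 h2
  have h3 : Continuous fun t => ∑ q ∈ Icc 1 ⌊Q⌋₊, ∑ a ∈ Icc (-(q : ℤ)) q, arcBound Q q a t :=
    continuous_finsetSum _ fun q _ => continuous_finsetSum _ fun a _ => continuous_arcBound hQ q a
  unfold arcMajorant
  fun_prop

lemma integral_arcBound_le {Q : ℝ} (hQ : 1 ≤ Q) {q : ℕ} (h1 : 1 ≤ q) (hq : (q : ℝ) ≤ Q) {a : ℤ}
    (ha : |a| ≤ q) : ∫ t in -Real.pi..Real.pi, arcBound Q q a t ≤
      4 * Real.pi * Q ^ 2 * ((q : ℝ) ^ (-(5 / 4) : ℝ) * |(a : ℝ)| ^ (-(5 / 4) : ℝ)) := by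
  have hQ0 : 0 < Q := by linarith
  have hq1 : (1 : ℝ) ≤ q := by exact_mod_cast h1
  rcases eq_or_ne a 0 with rfl | ha0
  · simp [arcBound]
  have haa : (1 : ℝ) ≤ |(a : ℝ)| := by exact_mod_cast Int.one_le_abs ha0
  have haq : |(a : ℝ)| ≤ q := by exact_mod_cast ha
  have hpi := Real.pi_pos
  have hc := continuous_inv_sq_add_sq (2 * Real.pi * a / q) (c := (Q ^ 2)⁻¹) (by positivity)
  unfold arcBound
  rw [intervalIntegral.integral_const_mul, intervalIntegral.integral_add
    ((hc.const_mul _).intervalIntegrable _ _) (by simp),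
    intervalIntegral.integral_const_mul, intervalIntegral.integral_const, smul_eq_mul]
  have h2 := integral_inv_sq_add_sq_le (2 * Real.pi * a / q) (c := (Q ^ 2)⁻¹) (by positivity)
    (-Real.pi) Real.pi
  rw [div_inv_eq_mul] at h2
  have h3 : Q * ((q : ℝ) ^ 2 / |(a : ℝ)| ^ 2) ≤ Q ^ 2 * (q / |(a : ℝ)|) := by
    have : (q : ℝ) ^ 2 / |(a : ℝ)| ^ 2 ≤ Q * (q / |(a : ℝ)|) := by
      rw [← div_pow, sq]
      gcongr
      rw [div_le_iff₀ (by positivity)]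
      nlinarith
    nlinarith
  have hr : |(a : ℝ)|⁻¹ ≤ (q : ℝ) ^ (1 / 4 : ℝ) * |(a : ℝ)| ^ (-(5 / 4) : ℝ) := by
    calc |(a : ℝ)|⁻¹ = |(a : ℝ)| ^ (1 / 4 : ℝ) * |(a : ℝ)| ^ (-(5 / 4) : ℝ) := by
          rw [← Real.rpow_add (by positivity), ← Real.rpow_neg_one]; norm_num
      _ ≤ _ := by gcongr
  have hqq : ((q : ℝ) ^ 2 * √q)⁻¹ * q * (q : ℝ) ^ (1 / 4 : ℝ) = (q : ℝ) ^ (-(5 / 4) : ℝ) := by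
    rw [Real.sqrt_eq_rpow, ← Real.rpow_natCast, ← Real.rpow_add (by positivity),
      ← Real.rpow_neg (by positivity)]
    nth_rw 2 [← Real.rpow_one (q : ℝ)]
    rw [← Real.rpow_add (by positivity), ← Real.rpow_add (by positivity)]
    norm_num
  calc _ ≤ ((q : ℝ) ^ 2 * √q)⁻¹ * (q / |(a : ℝ)| * (Real.pi * Q ^ 2) +
        (Real.pi - -Real.pi) * (Q ^ 2 * (q / |(a : ℝ)|))) := by
        gcongr
        linarith
    _ = 3 * Real.pi * Q ^ 2 * (((q : ℝ) ^ 2 * √q)⁻¹ * q * |(a : ℝ)|⁻¹) := by ring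
    _ ≤ 4 * Real.pi * Q ^ 2 * (((q : ℝ) ^ 2 * √q)⁻¹ * q *
        ((q : ℝ) ^ (1 / 4 : ℝ) * |(a : ℝ)| ^ (-(5 / 4) : ℝ))) := by gcongr; norm_num
    _ = _ := by rw [← mul_assoc _ ((q : ℝ) ^ (1 / 4 : ℝ)), hqq]

lemma exists_integral_arcMajorant_le : ∃ C > 0, ∀ Q : ℝ, 1 ≤ Q →
    ∫ t in -Real.pi..Real.pi, arcMajorant Q t ≤ C * Q ^ 2 := by
  have hs1 : Summable fun q : ℕ => (q : ℝ) ^ (-(5 / 4) : ℝ) :=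
    Real.summable_nat_rpow.2 (by norm_num)
  have hs2 : Summable fun a : ℤ => |(a : ℝ)| ^ (-(5 / 4) : ℝ) :=
    Real.summable_abs_int_rpow (by norm_num)
  set Z₁ := ∑' q : ℕ, (q : ℝ) ^ (-(5 / 4) : ℝ) with hZ₁
  set Z₂ := ∑' a : ℤ, |(a : ℝ)| ^ (-(5 / 4) : ℝ) with hZ₂
  have hZ₁0 : 0 ≤ Z₁ := tsum_nonneg fun _ => by positivity
  have hZ₂0 : 0 ≤ Z₂ := tsum_nonneg fun _ => by positivity
  have hpi := Real.pi_pos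
  refine ⟨2 * Real.pi + 4 * Real.pi * (Z₁ * Z₂), by positivity, fun Q hQ => ?_⟩
  have hQ0 : 0 < Q := by linarith
  have hc1 := continuous_inv_sq_add_sq 0 (c := (Q ^ 2)⁻¹) (by positivity)
  have hc2 := continuous_inv_sq_add_sq 0 (c := Q⁻¹) (by positivity)
  have h1 := integral_inv_sq_add_sq_le 0 (c := (Q ^ 2)⁻¹) (by positivity) (-Real.pi) Real.pi
  have h2 := integral_inv_sq_add_sq_le 0 (c := Q⁻¹) (by positivity) (-Real.pi) Real.pi
  simp only [sub_zero, div_inv_eq_mul] at h1 h2 hc1 hc2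
  have h3 : ∫ t in -Real.pi..Real.pi,
      ∑ q ∈ Icc 1 ⌊Q⌋₊, ∑ a ∈ Icc (-(q : ℤ)) q, arcBound Q q a t ≤
      4 * Real.pi * Q ^ 2 * (Z₁ * Z₂) := by
    rw [intervalIntegral.integral_finsetSum fun q _ => (continuous_finsetSum _
      fun a _ => continuous_arcBound hQ0 q a).intervalIntegrable _ _]
    calc _ ≤ ∑ q ∈ Icc 1 ⌊Q⌋₊, ∑ a ∈ Icc (-(q : ℤ)) q,
          4 * Real.pi * Q ^ 2 * ((q : ℝ) ^ (-(5 / 4) : ℝ) * |(a : ℝ)| ^ (-(5 / 4) : ℝ)) := by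
          refine sum_le_sum fun q hq => ?_
          rw [intervalIntegral.integral_finsetSum fun a _ =>
            (continuous_arcBound hQ0 q a).intervalIntegrable _ _]
          rw [mem_Icc] at hq
          exact sum_le_sum fun a ha => integral_arcBound_le hQ hq.1
            ((Nat.cast_le.2 hq.2).trans (Nat.floor_le hQ0.le)) (abs_le.2 (mem_Icc.1 ha))
      _ = 4 * Real.pi * Q ^ 2 * ∑ q ∈ Icc 1 ⌊Q⌋₊, (q : ℝ) ^ (-(5 / 4) : ℝ) *
          ∑ a ∈ Icc (-(q : ℤ)) q, |(a : ℝ)| ^ (-(5 / 4) : ℝ) := by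
          simp_rw [mul_sum]
      _ ≤ 4 * Real.pi * Q ^ 2 * ∑ q ∈ Icc 1 ⌊Q⌋₊, (q : ℝ) ^ (-(5 / 4) : ℝ) * Z₂ := by
          gcongr with q hq
          exact hs2.sum_le_tsum _ fun _ _ => by positivity
      _ ≤ _ := by
          rw [← sum_mul]
          gcongr
          exact hs1.sum_le_tsum _ fun _ _ => by positivity
  have hc3 : Continuous fun t : ℝ => Q * (t ^ 2 + Q⁻¹ ^ 2)⁻¹ + (t ^ 2 + (Q ^ 2)⁻¹ ^ 2)⁻¹ :=
    (hc2.const_mul _).add hc1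
  unfold arcMajorant
  rw [intervalIntegral.integral_add (hc3.intervalIntegrable _ _)
    ((continuous_finsetSum _ fun q _ => continuous_finsetSum _
      fun a _ => continuous_arcBound hQ0 q a).intervalIntegrable _ _),
    intervalIntegral.integral_add ((hc2.const_mul _).intervalIntegrable _ _)
      (hc1.intervalIntegrable _ _), intervalIntegral.integral_const_mul]
  nlinarith

lemma integral_exp_int_mul (y : ℝ) (l : ℤ) :
    ∫ t in -Real.pi..Real.pi, Complex.exp (l * (y + t * Complex.I)) =
      if l = 0 then (2 * Real.pi : ℂ) else 0 := by
  split_ifs with h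
  · simp [h]; ring
  · have h1 : ∀ t : ℝ, Complex.exp (l * (y + t * Complex.I)) =
        Complex.exp (l * y) * Complex.exp ((l * Complex.I) * t) := fun t => by
      rw [← Complex.exp_add]; congr 1; ring
    simp_rw [h1]
    rw [intervalIntegral.integral_const_mul, integral_exp_mul_complex (by simp [h])]
    have : Complex.exp (l * Complex.I * (Real.pi : ℝ)) =
        Complex.exp (l * Complex.I * (-Real.pi : ℝ)) :=
      Complex.exp_eq_exp_iff_exists_int.2 ⟨l, by push_cast; ring⟩
    rw [this]; simp

lemma integral_exp_mul_kernel (y : ℝ) (u N : ℕ) :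
    ∫ t in -Real.pi..Real.pi, Complex.exp (-u * (y + t * Complex.I)) *
      kernel N (y + t * Complex.I) = if u ≤ N then (2 * Real.pi : ℂ) else 0 := by
  unfold kernel
  simp_rw [mul_sum, ← Complex.exp_add]
  rw [intervalIntegral.integral_finsetSum fun k _ => by
    apply Continuous.intervalIntegrable; fun_prop]
  have h : ∀ k : ℕ, ∫ t in -Real.pi..Real.pi, Complex.exp (-u * (y + t * Complex.I) +
      k * (y + t * Complex.I)) = if k = u then (2 * Real.pi : ℂ) else 0 := fun k => by
    have := integral_exp_int_mul y ((k : ℤ) - u)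
    simp only [sub_eq_zero, Nat.cast_inj] at this
    rw [← this]
    congr 1; ext t; congr 1; push_cast; ring
  simp_rw [h]
  rw [sum_ite_eq']
  simp

lemma integral_tsum_mul_kernel {ι : Type*} [Countable ι] (c : ι → ℂ) (u : ι → ℕ) (y : ℝ) (N : ℕ)
    (h : Summable fun i => ‖c i‖ * Real.exp (-(u i * y))) :
    ∫ t in -Real.pi..Real.pi, (∑' i, c i * Complex.exp (-u i * (y + t * Complex.I))) *
      kernel N (y + t * Complex.I) = 2 * Real.pi * ∑' i, if u i ≤ N then c i else 0 := by
  have hn : ∀ (i : ι) (t : ℝ), ‖c i * Complex.exp (-u i * (y + t * Complex.I))‖ =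
      ‖c i‖ * Real.exp (-(u i * y)) := fun i t => by
    rw [norm_mul, Complex.norm_exp]
    congr 2
    simp
  set K : ℝ := ∑ k ∈ range (N + 1), Real.exp (k * y) with hK
  have hk : ∀ t : ℝ, ‖kernel N (y + t * Complex.I)‖ ≤ K := fun t => by
    refine (norm_sum_le _ _).trans (sum_le_sum fun k _ => ?_)
    rw [Complex.norm_exp]
    simp
  have key := intervalIntegral.hasSum_integral_of_dominated_convergence (μ := volume)
    (a := -Real.pi) (b := Real.pi)
    (F := fun i (t : ℝ) => c i * Complex.exp (-u i * (y + t * Complex.I)) *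
      kernel N (y + t * Complex.I))
    (f := fun t : ℝ => (∑' i, c i * Complex.exp (-u i * (y + t * Complex.I))) *
      kernel N (y + t * Complex.I))
    (fun i _ => ‖c i‖ * Real.exp (-(u i * y)) * K)
    (fun i => by
      apply Continuous.aestronglyMeasurable
      unfold kernel
      fun_prop)
    (fun i => ae_of_all _ fun t _ => by
      rw [norm_mul, hn]
      gcongr
      exact hk t)
    (ae_of_all _ fun t _ => h.mul_right K) intervalIntegrable_const
    (ae_of_all _ fun t _ => by
      apply HasSum.mul_right
      exact (Summable.of_norm (by simpa only [hn] using h)).hasSum)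
  rw [← key.tsum_eq, ← tsum_mul_left]
  congr 1; ext i
  simp_rw [mul_assoc (c i)]
  rw [intervalIntegral.integral_const_mul, integral_exp_mul_kernel]
  split_ifs <;> ring

lemma prod_tsum_eq_tsum_prod {n : ℕ} (f : Fin n → ℤ → ℂ) (hf : ∀ i, Summable fun b => ‖f i b‖) :
    (Summable fun b : Fin n → ℤ => ‖∏ i, f i (b i)‖) ∧
      ∏ i, ∑' b, f i b = ∑' b : Fin n → ℤ, ∏ i, f i (b i) := by
  induction n with
  | zero => simp [Summable.of_finite]
  | succ n ih =>
    obtain ⟨ih1, ih2⟩ := ih (fun i => f i.succ) fun i => hf _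
    have e : ∀ x : ℤ × (Fin n → ℤ), ∏ i, f i (Fin.consEquiv (fun _ => ℤ) x i) =
        f 0 x.1 * ∏ i : Fin n, f i.succ (x.2 i) := fun x => by
      rw [Fin.prod_univ_succ]; simp [Fin.consEquiv]
    constructor
    · rw [← (Fin.consEquiv fun _ => ℤ).summable_iff]
      have := Summable.mul_norm (hf 0) ih1
      refine this.congr fun x => ?_
      rw [Function.comp_apply, e]
    · rw [Fin.prod_univ_succ, ih2, tsum_mul_tsum_of_summable_norm (hf 0) ih1,
        ← (Fin.consEquiv fun _ => ℤ).tsum_eq]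
      exact tsum_congr fun x => (e x).symm

lemma prod_theta_eq {n : ℕ} (α : Fin n → ℕ) {s : ℂ} (hs : 0 < s.re) :
    (Summable fun b : Fin n → ℤ => ‖∏ i, (b i : ℂ) ^ (2 * α i)‖ *
      Real.exp (-((∑ i, (b i).natAbs ^ 2 : ℕ) * s.re))) ∧
    ∏ i, theta (α i) s = ∑' b : Fin n → ℤ, (∏ i, (b i : ℂ) ^ (2 * α i)) *
      Complex.exp (-(∑ i, (b i).natAbs ^ 2 : ℕ) * s) := by
  have h := prod_tsum_eq_tsum_prod (fun i (b : ℤ) => (b : ℂ) ^ (2 * α i) * Complex.exp (-s * b ^ 2))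
    fun i => (summable_theta_term (α i) hs).norm
  have hc : ∀ b : Fin n → ℤ, ((∑ i, (b i).natAbs ^ 2 : ℕ) : ℂ) = ∑ i, (b i : ℂ) ^ 2 := fun b => by
    push_cast
    refine sum_congr rfl fun i _ => ?_
    rw [← Int.cast_natCast, ← Int.cast_pow, Int.natCast_natAbs, sq_abs, Int.cast_pow]
  have e : ∀ b : Fin n → ℤ, ∏ i, ((b i : ℂ) ^ (2 * α i) * Complex.exp (-s * b i ^ 2)) =
      (∏ i, (b i : ℂ) ^ (2 * α i)) * Complex.exp (-(∑ i, (b i).natAbs ^ 2 : ℕ) * s) := fun b => by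
    rw [prod_mul_distrib, ← Complex.exp_sum, hc]
    congr 2
    rw [← mul_sum]; ring
  simp_rw [e] at h
  refine ⟨h.1.congr fun b => ?_, h.2⟩
  rw [norm_mul, Complex.norm_exp, ← Complex.ofReal_natCast, ← Complex.ofReal_neg,
    Complex.re_ofReal_mul, neg_mul]

lemma rootSing_pow_hasSum (m : ℕ) {s : ℂ} (hs : 0 < s.re) :
    HasSum (fun k : ℕ => Ring.multichoose ((m : ℂ) / 2) k * Complex.exp (-k * s))
      (rootSing s ^ m) := by
  have h := (Complex.one_div_one_sub_cpow_hasFPowerSeriesOnBall_zero ((m : ℂ) / 2)).hasSum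
    (y := Complex.exp (-s)) (by
      rw [Metric.mem_eball, edist_zero_right, ← ofReal_norm, Complex.norm_exp]
      simpa using hs)
  simp_rw [FormalMultilinearSeries.ofScalars_apply_eq, zero_add, smul_eq_mul,
    ← Complex.exp_nat_mul] at h
  have e : rootSing s ^ m = 1 / (1 - Complex.exp (-s)) ^ ((m : ℂ) / 2) := by
    rw [rootSing, div_pow, one_pow, ← Complex.cpow_nat_mul]
    congr 2; ring
  rw [e]
  refine h.congr_fun fun k => ?_
  rw [Ring.multichoose_eq, mul_neg, neg_mul]

lemma sum_multichoose (r : ℂ) (N : ℕ) :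
    ∑ k ∈ range (N + 1), Ring.multichoose r k = Ring.multichoose (r + 1) N := by
  induction N with
  | zero => simp
  | succ N ih => rw [sum_range_succ, ih, Ring.multichoose_succ_succ, add_comm]

lemma multichoose_add_one_eq_prod (r : ℂ) (N : ℕ) :
    Ring.multichoose (r + 1) N = ∏ i ∈ range N, (1 + r / (i + 1)) := by
  induction N with
  | zero => simp
  | succ N ih =>
    rw [prod_range_succ, ← ih]
    have h1 := Ring.factorial_nsmul_multichoose_eq_ascPochhammer (r + 1) N
    have h2 := Ring.factorial_nsmul_multichoose_eq_ascPochhammer (r + 1) (N + 1)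
    rw [Polynomial.ascPochhammer_smeval_eq_eval] at h1 h2
    rw [ascPochhammer_succ_eval, ← h1] at h2
    simp only [nsmul_eq_mul, Nat.factorial_succ] at h2
    push_cast at h2
    have h3 : (N.factorial : ℂ) ≠ 0 := by exact_mod_cast N.factorial_ne_zero
    have h4 : (N + 1 : ℂ) ≠ 0 := by exact_mod_cast N.succ_ne_zero
    apply mul_left_cancel₀ (mul_ne_zero h4 h3)
    rw [h2]
    field_simp
    ring

section

lemma continuous_theta_line (j : ℕ) {y : ℝ} (hy : 0 < y) :
    Continuous fun t : ℝ => theta j (y + t * Complex.I) :=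
  continuous_iff_continuousAt.2 fun t =>
    ContinuousAt.comp (f := fun t : ℝ => (y + t * Complex.I : ℂ))
      (hasDerivAt_theta j (by simpa using hy)).continuousAt (by fun_prop)

lemma continuous_rootSing_line {y : ℝ} (hy : 0 < y) :
    Continuous fun t : ℝ => rootSing (y + t * Complex.I) := by
  have h0 : ∀ t : ℝ, 1 - Complex.exp (-(y + t * Complex.I)) ∈ Complex.slitPlane := fun t => by
    left
    have h1 := Complex.re_le_norm (Complex.exp (-(y + t * Complex.I)))
    have h2 : ‖Complex.exp (-(y + t * Complex.I))‖ < 1 := by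
      rw [Complex.norm_exp]; simpa using hy
    simp only [Complex.sub_re, Complex.one_re]
    linarith
  unfold rootSing
  refine Continuous.div continuous_const (Continuous.cpow (by fun_prop) continuous_const h0)
    fun t => ?_
  rw [Complex.cpow_ne_zero_iff]
  exact Or.inl (Complex.slitPlane_ne_zero (h0 t))

lemma continuous_kernel_line (N : ℕ) (y : ℝ) :
    Continuous fun t : ℝ => kernel N (y + t * Complex.I) := by
  unfold kernel
  fun_prop

variable {k : ℕ}

lemma exists_norm_lattice_sum_sub_le (α : Fin (k + 5) → ℕ) : ∃ C > 0, ∀ N : ℕ, 0 < N →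
    ‖(∑' b : Fin (k + 5) → ℤ, if ∑ i, (b i).natAbs ^ 2 ≤ N then
        ∏ i, (b i : ℂ) ^ (2 * α i) else 0) - (∏ i, (thetaConst (α i) : ℂ)) *
        ∏ i ∈ range N, (1 + ((2 * ∑ i, α i + k + 5 : ℕ) : ℂ) / 2 / (i + 1))‖ ≤
      C * √N ^ (2 * ∑ i, α i + k + 3) := by
  obtain ⟨C₁, hC₁, h₁⟩ := exists_norm_error_mul_kernel_le α
  obtain ⟨C₂, hC₂, h₂⟩ := exists_integral_arcMajorant_le
  refine ⟨C₁ * C₂, by positivity, fun N hN => ?_⟩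
  have hN1 : (1 : ℝ) ≤ N := by exact_mod_cast hN
  have hpi := Real.pi_gt_three
  set y : ℝ := (N : ℝ)⁻¹ with hy
  have hy0 : 0 < y := by positivity
  have hre : ∀ t : ℝ, (y + t * Complex.I : ℂ).re = y := fun t => by simp
  have him : ∀ t : ℝ, (y + t * Complex.I : ℂ).im = t := fun t => by simp
  set P := 2 * ∑ i, α i + k + 5 with hP
  have hf := integral_tsum_mul_kernel (fun b : Fin (k + 5) → ℤ => ∏ i, (b i : ℂ) ^ (2 * α i))
    (fun b => ∑ i, (b i).natAbs ^ 2) y N (by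
      simpa using (prod_theta_eq α (s := (y : ℂ)) (by simpa using hy0)).1)
  have hg := integral_tsum_mul_kernel (fun j : ℕ => Ring.multichoose ((P : ℂ) / 2) j)
    (fun j => j) y N (by
      refine (rootSing_pow_hasSum P (s := (y : ℂ)) (by simpa using hy0)).summable.norm.congr
        fun j => ?_
      rw [norm_mul, Complex.norm_exp]
      simp)
  have hf' : ∀ t : ℝ, ∑' b : Fin (k + 5) → ℤ, (∏ i, (b i : ℂ) ^ (2 * α i)) *
      Complex.exp (-(∑ i, (b i).natAbs ^ 2 : ℕ) * (y + t * Complex.I)) =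
      ∏ i, theta (α i) (y + t * Complex.I) := fun t =>
    (prod_theta_eq α (by rwa [hre])).2.symm
  have hg' : ∀ t : ℝ, ∑' j : ℕ, Ring.multichoose ((P : ℂ) / 2) j *
      Complex.exp (-j * (y + t * Complex.I)) = rootSing (y + t * Complex.I) ^ P := fun t =>
    (rootSing_pow_hasSum P (by rwa [hre])).tsum_eq
  simp_rw [hf'] at hf
  simp_rw [hg'] at hg
  have hsum : ∑' j : ℕ, (if j ≤ N then Ring.multichoose ((P : ℂ) / 2) j else 0) =
      ∏ i ∈ range N, (1 + (P : ℂ) / 2 / (i + 1)) := by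
    rw [← multichoose_add_one_eq_prod, ← sum_multichoose, tsum_eq_sum (s := range (N + 1))]
    · refine sum_congr rfl fun j hj => if_pos ?_
      rw [mem_range] at hj; omega
    · intro j hj
      rw [mem_range] at hj
      exact if_neg (by omega)
  rw [hsum] at hg
  set κ : ℂ := ∏ i, (thetaConst (α i) : ℂ) with hκ
  set S := ∑' b : Fin (k + 5) → ℤ, if ∑ i, (b i).natAbs ^ 2 ≤ N then
        ∏ i, (b i : ℂ) ^ (2 * α i) else 0 with hS
  have cK := continuous_kernel_line N y
  have cR := continuous_rootSing_line hy0
  have cT : Continuous fun t : ℝ => ∏ i, theta (α i) (y + t * Complex.I) :=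
    continuous_finsetProd _ fun i _ => continuous_theta_line (α i) hy0
  have hint : ∫ t in -Real.pi..Real.pi, (∏ i, theta (α i) (y + t * Complex.I) -
      κ * rootSing (y + t * Complex.I) ^ P) * kernel N (y + t * Complex.I) =
      2 * Real.pi * (S - κ * ∏ i ∈ range N, (1 + (P : ℂ) / 2 / (i + 1))) := by
    have c1 : Continuous fun t : ℝ => (∏ i, theta (α i) (y + t * Complex.I)) *
      kernel N (y + t * Complex.I) := cT.mul cK
    have c2 : Continuous fun t : ℝ => κ * (rootSing (y + t * Complex.I) ^ P *
      kernel N (y + t * Complex.I)) := continuous_const.mul ((cR.pow P).mul cK)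
    rw [mul_sub, mul_left_comm, ← hf, ← hg, ← intervalIntegral.integral_const_mul,
      ← intervalIntegral.integral_sub (c1.intervalIntegrable _ _) (c2.intervalIntegrable _ _)]
    congr 1; ext t; ring
  have hQ : 1 ≤ √(N : ℝ) := Real.one_le_sqrt.2 hN1
  have hbound := intervalIntegral.norm_integral_le_of_norm_le (μ := volume)
    (by linarith : -Real.pi ≤ Real.pi)
    (f := fun t : ℝ => (∏ i, theta (α i) (y + t * Complex.I) -
      κ * rootSing (y + t * Complex.I) ^ P) * kernel N (y + t * Complex.I))
    (g := fun t => C₁ * (√N ^ (2 * ∑ i, α i + k + 1) * arcMajorant √N t))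
    (ae_of_all _ fun t ht => by
      have := h₁ N √N (y + t * Complex.I) hN (by positivity) (Real.sq_sqrt (by positivity))
        (hre t) (by rw [him, abs_le]; exact ⟨ht.1.le, ht.2⟩)
      rwa [him] at this)
    (((continuous_arcMajorant (by positivity)).const_mul _ |>.const_mul _).intervalIntegrable _ _)
  rw [hint, intervalIntegral.integral_const_mul, intervalIntegral.integral_const_mul,
    norm_mul] at hbound
  have h2pi : 1 ≤ ‖(2 * Real.pi : ℂ)‖ := by
    rw [norm_mul, Complex.norm_real, Real.norm_of_nonneg (by positivity)]
    simp; linarith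
  have h3 := h₂ √N hQ
  calc _ ≤ ‖(2 * Real.pi : ℂ)‖ * ‖S - κ * ∏ i ∈ range N, (1 + (P : ℂ) / 2 / (i + 1))‖ :=
        le_mul_of_one_le_left (norm_nonneg _) h2pi
    _ ≤ _ := hbound
    _ ≤ C₁ * (√N ^ (2 * ∑ i, α i + k + 1) * (C₂ * √N ^ 2)) := by gcongr
    _ = _ := by ring

end

section

lemma one_add_mul_rpow_one_sub_le {p x : ℝ} (hp : 0 ≤ p) (hx1 : x ≤ 1) :
    (1 + p * x) * (1 - x) ^ p ≤ 1 := by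
  have h1 : 1 + p * x ≤ Real.exp (p * x) := by linarith [Real.add_one_le_exp (p * x)]
  have h2 : (1 - x) ^ p ≤ Real.exp (-(p * x)) := by
    calc (1 - x) ^ p ≤ Real.exp (-x) ^ p := by
          have := Real.one_sub_le_exp_neg x
          have : 0 ≤ 1 - x := by linarith
          gcongr
      _ = _ := by rw [← Real.exp_mul]; ring_nf
  have : 0 ≤ 1 - x := by linarith
  calc _ ≤ Real.exp (p * x) * Real.exp (-(p * x)) := by gcongr
    _ = 1 := by rw [← Real.exp_add]; simp

lemma le_one_add_mul_rpow_one_sub {p x : ℝ} (hp : 1 ≤ p) (hx0 : 0 ≤ x) (hx1 : x ≤ 1) :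
    1 - p ^ 2 * x ^ 2 ≤ (1 + p * x) * (1 - x) ^ p := by
  have h := one_add_mul_self_le_rpow_one_add (s := -x) (by linarith) hp
  rw [← sub_eq_add_neg] at h
  nlinarith [mul_nonneg (by linarith : 0 ≤ p) hx0]

lemma exists_prod_one_add_div_sub_le {p : ℝ} (hp : 1 ≤ p) : ∃ c C : ℝ, 0 ≤ C ∧ ∀ N : ℕ, 0 < N →
    |∏ i ∈ range N, (1 + p / (i + 1)) - c * (N : ℝ) ^ p| ≤ C * (N : ℝ) ^ (p - 1) := by
  set G : ℕ → ℝ := fun N => ∏ i ∈ range N, (1 + p / (i + 1)) with hG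
  have hG0 : ∀ N, 0 < G N := fun N => prod_pos fun i _ => by positivity
  set u : ℕ → ℝ := fun N => G (N + 1) / ((N + 1 : ℕ) : ℝ) ^ p with hu
  have hu0 : ∀ N, 0 < u N := fun N => div_pos (hG0 _) (by positivity)
  have hstep : ∀ N, u (N + 1) = u N * ((1 + p * (1 / (N + 2))) * (1 - 1 / (N + 2)) ^ p) := fun N => by
    have e : (1 - 1 / ((N : ℝ) + 2)) = (N + 1 : ℕ) / (N + 2) := by push_cast; field_simp; ring
    rw [e, Real.div_rpow (by positivity) (by positivity)]
    simp only [hu]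
    have e2 : G (N + 1 + 1) = G (N + 1) * (1 + p * (1 / (N + 2))) := by
      simp only [hG]
      rw [prod_range_succ _ (N + 1)]
      push_cast
      congr 1; ring
    rw [e2]
    have e3 : (((N + 1 + 1 : ℕ) : ℝ)) = N + 2 := by push_cast; ring
    rw [e3]
    have : ((N + 1 : ℕ) : ℝ) ^ p ≠ 0 := by positivity
    field_simp
  have hx : ∀ N : ℕ, 0 ≤ 1 / ((N : ℝ) + 2) ∧ 1 / ((N : ℝ) + 2) ≤ 1 := fun N =>
    ⟨by positivity, by rw [div_le_one (by positivity)]; linarith [(N.cast_nonneg : (0 : ℝ) ≤ N)]⟩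
  have hanti : Antitone u := antitone_nat_of_succ_le fun N => by
    rw [hstep]
    exact mul_le_of_le_one_right (hu0 N).le
      (one_add_mul_rpow_one_sub_le (by linarith) (hx N).2)
  obtain ⟨c, hc⟩ : ∃ c, Tendsto u atTop (nhds c) :=
    ⟨_, tendsto_atTop_ciInf hanti ⟨0, by rintro _ ⟨N, rfl⟩; exact (hu0 N).le⟩⟩
  set K := u 0 * p ^ 2 with hK
  have hK0 : 0 ≤ K := by have := hu0 0; positivity
  have hmono : Monotone fun N : ℕ => u N - K * (1 / ((N : ℝ) + 1)) := monotone_nat_of_le_succ fun N => by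
    have h1 := le_one_add_mul_rpow_one_sub hp (hx N).1 (hx N).2
    have h2 : u N - u 0 * (p ^ 2 * (1 / ((N : ℝ) + 2)) ^ 2) ≤ u (N + 1) := by
      rw [hstep]
      have h3 := hanti (Nat.zero_le N)
      have h4 : 0 ≤ p ^ 2 * (1 / ((N : ℝ) + 2)) ^ 2 := by positivity
      nlinarith [hu0 N]
    have h5 : (1 / ((N : ℝ) + 2)) ^ 2 ≤ 1 / ((N : ℝ) + 1) - 1 / ((N : ℝ) + 2) := by
      rw [div_sub_div _ _ (by positivity) (by positivity), div_pow, one_pow]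
      rw [div_le_div_iff₀ (by positivity) (by positivity)]
      nlinarith [(N.cast_nonneg : (0 : ℝ) ≤ N)]
    have h6 := mul_le_mul_of_nonneg_left h5 hK0
    push_cast
    rw [show ((N : ℝ) + 1 + 1) = N + 2 by ring]
    rw [hK] at h6 ⊢
    linarith
  have hlim : Tendsto (fun N : ℕ => u N - K * (1 / ((N : ℝ) + 1))) atTop (nhds c) := by
    simpa using hc.sub (tendsto_one_div_add_atTop_nhds_zero_nat.const_mul K)
  refine ⟨c, K, hK0, fun N hN => ?_⟩
  obtain ⟨M, rfl⟩ : ∃ M, N = M + 1 := ⟨N - 1, by omega⟩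
  have h1 := hanti.le_of_tendsto hc M
  have h2 := hmono.ge_of_tendsto hlim M
  have h3 : 0 < ((M + 1 : ℕ) : ℝ) ^ p := by positivity
  have e : ∏ i ∈ range (M + 1), (1 + p / ((i : ℝ) + 1)) - c * ((M + 1 : ℕ) : ℝ) ^ p =
      (u M - c) * ((M + 1 : ℕ) : ℝ) ^ p := by
    simp only [hu, hG]; field_simp
  rw [e, abs_of_nonneg (mul_nonneg (by linarith) h3.le), Real.rpow_sub_one (by positivity)]
  have h4 : u M - c ≤ K * (1 / ((M : ℝ) + 1)) := by linarith
  calc _ ≤ K * (1 / ((M : ℝ) + 1)) * ((M + 1 : ℕ) : ℝ) ^ p := by gcongr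
    _ = _ := by push_cast; ring

lemma finite_lattice_ball {n : ℕ} (N : ℕ) :
    {b : Fin n → ℤ | ∑ i, (b i).natAbs ^ 2 ≤ N}.Finite := by
  refine (Set.finite_Icc (fun _ => -(N : ℤ)) fun _ => (N : ℤ)).subset fun b hb => ?_
  have h : ∀ i, (b i).natAbs ≤ N := fun i => by
    have h1 := single_le_sum (f := fun i => (b i).natAbs ^ 2) (fun _ _ => Nat.zero_le _) (mem_univ i)
    have h2 := Nat.le_self_pow two_ne_zero (b i).natAbs
    exact h2.trans (h1.trans hb)
  exact ⟨fun i => by have := h i; simp only; omega, fun i => by have := h i; simp only; omega⟩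

lemma summable_lattice_ball {n : ℕ} (N : ℕ) (f : (Fin n → ℤ) → ℝ) :
    Summable fun b : Fin n → ℤ => if ∑ i, (b i).natAbs ^ 2 ≤ N then f b else 0 :=
  summable_of_hasFiniteSupport ((finite_lattice_ball N).subset fun b hb => by
    by_contra h
    exact hb (if_neg h))

variable {k : ℕ}

lemma exists_monomial_sum_sub_le (α : Fin (k + 5) → ℕ) : ∃ c C : ℝ, 0 ≤ C ∧ ∀ N : ℕ, 0 < N →
    |(∑' b : Fin (k + 5) → ℤ, if ∑ i, (b i).natAbs ^ 2 ≤ N then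
        ∏ i, (b i : ℝ) ^ (2 * α i) else 0) -
        c * (N : ℝ) ^ (((2 * ∑ i, α i + k + 5 : ℕ) : ℝ) / 2)| ≤
      C * (N : ℝ) ^ (((2 * ∑ i, α i + k + 5 : ℕ) : ℝ) / 2 - 1) := by
  obtain ⟨C₁, hC₁, h₁⟩ := exists_norm_lattice_sum_sub_le α
  set P := 2 * ∑ i, α i + k + 5 with hP
  have hp : (1 : ℝ) ≤ (P : ℝ) / 2 := by rw [hP]; push_cast; linarith [
    (by positivity : (0 : ℝ) ≤ 2 * ∑ i, (α i : ℝ) + k)]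
  obtain ⟨c, C₂, hC₂, h₂⟩ := exists_prod_one_add_div_sub_le hp
  set κ : ℝ := ∏ i, thetaConst (α i) with hκ
  have hκ0 : 0 ≤ κ := prod_nonneg fun i _ => thetaConst_nonneg _
  refine ⟨κ * c, C₁ + κ * C₂, by positivity, fun N hN => ?_⟩
  have hN0 : (0 : ℝ) < N := by exact_mod_cast hN
  have h1 := h₁ N hN
  have e1 : (√(N : ℝ)) ^ (2 * ∑ i, α i + k + 3) = (N : ℝ) ^ ((P : ℝ) / 2 - 1) := by
    rw [Real.sqrt_eq_rpow, ← Real.rpow_natCast, ← Real.rpow_mul hN0.le]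
    congr 1
    rw [hP]; push_cast; ring
  set S := ∑' b : Fin (k + 5) → ℤ, if ∑ i, (b i).natAbs ^ 2 ≤ N then
        ∏ i, (b i : ℝ) ^ (2 * α i) else 0 with hS
  set G : ℝ := ∏ i ∈ range N, (1 + (P : ℝ) / 2 / (i + 1)) with hG
  have e2 : (∑' b : Fin (k + 5) → ℤ, if ∑ i, (b i).natAbs ^ 2 ≤ N then
        ∏ i, (b i : ℂ) ^ (2 * α i) else 0) - (∏ i, (thetaConst (α i) : ℂ)) *
        ∏ i ∈ range N, (1 + (P : ℂ) / 2 / (i + 1)) = ((S - κ * G : ℝ) : ℂ) := by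
    rw [hS, hκ, hG]
    push_cast
    congr 1
    exact tsum_congr fun b => by split_ifs <;> simp
  rw [e2, e1, Complex.norm_real, Real.norm_eq_abs] at h1
  have h2 := h₂ N hN
  calc |S - κ * c * (N : ℝ) ^ ((P : ℝ) / 2)|
      = |(S - κ * G) + κ * (G - c * (N : ℝ) ^ ((P : ℝ) / 2))| := by congr 1; ring
    _ ≤ C₁ * (N : ℝ) ^ ((P : ℝ) / 2 - 1) + κ * (C₂ * (N : ℝ) ^ ((P : ℝ) / 2 - 1)) := by
        refine (abs_add_le _ _).trans (add_le_add h1 ?_)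
        rw [abs_mul, abs_of_nonneg hκ0]
        gcongr
    _ = _ := by ring

lemma sum_eq_of_isHomogeneous {n A : ℕ} {q : MvPolynomial (Fin n) ℝ} (hq : q.IsHomogeneous A)
    {d : Fin n →₀ ℕ} (hd : d ∈ q.support) : ∑ i, d i = A := by
  rw [← hq (MvPolynomial.mem_support_iff.1 hd), Finsupp.weight_apply,
    Finsupp.sum_fintype _ _ (by simp)]
  simp

/-- Sharp asymptotics for the sum of a homogeneous even polynomial over lattice points in a ball. -/
lemma exists_polynomial_sum_sub_le {A : ℕ} (q : MvPolynomial (Fin (k + 5)) ℝ)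
    (hq : q.IsHomogeneous A) : ∃ c C : ℝ, 0 ≤ C ∧ ∀ N : ℕ, 0 < N →
    |(∑' b : Fin (k + 5) → ℤ, if ∑ i, (b i).natAbs ^ 2 ≤ N then
        MvPolynomial.eval (fun i => (b i : ℝ) ^ 2) q else 0) -
        c * (N : ℝ) ^ (((2 * A + k + 5 : ℕ) : ℝ) / 2)| ≤
      C * (N : ℝ) ^ (((2 * A + k + 5 : ℕ) : ℝ) / 2 - 1) := by
  choose c C hC h using fun α : Fin (k + 5) → ℕ => exists_monomial_sum_sub_le α
  refine ⟨∑ d ∈ q.support, q.coeff d * c d, ∑ d ∈ q.support, |q.coeff d| * C d,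
    sum_nonneg fun d _ => mul_nonneg (abs_nonneg _) (hC _), fun N hN => ?_⟩
  have e : (∑' b : Fin (k + 5) → ℤ, if ∑ i, (b i).natAbs ^ 2 ≤ N then
        MvPolynomial.eval (fun i => (b i : ℝ) ^ 2) q else 0) = ∑ d ∈ q.support, q.coeff d *
      ∑' b : Fin (k + 5) → ℤ, if ∑ i, (b i).natAbs ^ 2 ≤ N then
        ∏ i, (b i : ℝ) ^ (2 * d i) else 0 := by
    simp_rw [← tsum_mul_left]
    rw [← Summable.tsum_finsetSum fun d _ => (summable_lattice_ball N _).mul_left _]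
    refine tsum_congr fun b => ?_
    split_ifs
    · rw [MvPolynomial.eval_eq']
      simp_rw [pow_mul]
    · simp
  rw [e, sum_mul, ← sum_sub_distrib, sum_mul]
  refine (abs_sum_le_sum_abs _ _).trans (sum_le_sum fun d hd => ?_)
  have hdA := sum_eq_of_isHomogeneous hq hd
  have := h d N hN
  rw [hdA] at this
  rw [mul_assoc (q.coeff d), ← mul_sub, abs_mul, mul_assoc]
  gcongr

end

section

variable {n : ℕ}

open scoped Pointwise in
lemma tsum_inter_inv_smul_span (F : (Fin n → ℝ) → ℝ) {j : ℕ} (hj : 0 < j) :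
    ∑' x : ↑({x : Fin n → ℝ | ∑ i, x i ^ 2 ≤ 1} ∩
      (j : ℝ)⁻¹ • (Submodule.span ℤ (Set.range (Pi.basisFun ℝ (Fin n))) : Set (Fin n → ℝ))), F x =
    ∑' b : Fin n → ℤ, if ∑ i, (b i).natAbs ^ 2 ≤ j ^ 2 then F fun i => (b i : ℝ) / j else 0 := by
  have hj0 : (0 : ℝ) < j := by exact_mod_cast hj
  have : NeZero j := ⟨hj.ne'⟩
  have hinj : Function.Injective fun (b : Fin n → ℤ) i => (b i : ℝ) / j := fun b b' h => by
    funext i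
    have := congrFun h i
    simpa [div_left_inj' hj0.ne'] using this
  rw [_root_.tsum_subtype, ← hinj.tsum_eq]
  · refine tsum_congr fun b => ?_
    have h1 : (fun i => (b i : ℝ) / j) ∈
        (j : ℝ)⁻¹ • (Submodule.span ℤ (Set.range (Pi.basisFun ℝ (Fin n))) : Set (Fin n → ℝ)) :=
      (BoxIntegral.unitPartition.mem_smul_span_iff (n := j)).2 fun i => ⟨b i, by
        simp [mul_div_cancel₀ _ hj0.ne']⟩
    have h2 : (fun i => (b i : ℝ) / j) ∈ {x : Fin n → ℝ | ∑ i, x i ^ 2 ≤ 1} ↔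
        ∑ i, (b i).natAbs ^ 2 ≤ j ^ 2 := by
      rw [Set.mem_ofPred_eq]
      simp_rw [div_pow]
      rw [← sum_div, div_le_one (by positivity), ← Nat.cast_le (α := ℝ)]
      push_cast
      simp_rw [Nat.cast_natAbs, Int.cast_abs, sq_abs]
    simp only [Set.indicator, Set.mem_inter_iff, h1, h2, and_true]
  · intro x hx
    have hx2 := (Set.support_indicator_subset hx).2
    choose b hb using (BoxIntegral.unitPartition.mem_smul_span_iff (n := j)).1 hx2
    refine ⟨b, funext fun i => ?_⟩
    have := hb i
    simp only [eq_intCast] at this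
    simp [this, mul_div_cancel_left₀ _ hj0.ne']

lemma setIntegral_closedBall_eq (F : (Fin n → ℝ) → ℝ) :
    ∫ x in Metric.closedBall (0 : EuclideanSpace ℝ (Fin n)) 1, F x.ofLp =
      ∫ x in {x : Fin n → ℝ | ∑ i, x i ^ 2 ≤ 1}, F x := by
  rw [← (PiLp.volume_preserving_ofLp (Fin n)).setIntegral_preimage_emb
    (MeasurableEquiv.toLp 2 (Fin n → ℝ)).symm.measurableEmbedding]
  congr 2
  ext x
  simp [EuclideanSpace.norm_eq, Real.sqrt_le_one]

lemma sum_sq_le_one_eq_preimage : {x : Fin n → ℝ | ∑ i, x i ^ 2 ≤ 1} =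
    (EuclideanSpace.equiv (Fin n) ℝ).symm ⁻¹' Metric.closedBall 0 1 := by
  ext x
  simp [EuclideanSpace.norm_eq, Real.sqrt_le_one]

lemma tendsto_lattice_sum_div_pow (F : (Fin n → ℝ) → ℝ) (hF : Continuous F) :
    Tendsto (fun j : ℕ => (∑' b : Fin n → ℤ,
        if ∑ i, (b i).natAbs ^ 2 ≤ j ^ 2 then F fun i => (b i : ℝ) / j else 0) / (j : ℝ) ^ n) atTop
      (nhds (∫ x in Metric.closedBall (0 : EuclideanSpace ℝ (Fin n)) 1, F x.ofLp)) := by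
  rw [setIntegral_closedBall_eq]
  have hs := sum_sq_le_one_eq_preimage (n := n)
  have hclosed : IsClosed {x : Fin n → ℝ | ∑ i, x i ^ 2 ≤ 1} :=
    isClosed_le (by fun_prop) continuous_const
  have h := tendsto_tsum_div_pow_atTop_integral {x : Fin n → ℝ | ∑ i, x i ^ 2 ≤ 1} F hF ?_
    hclosed.measurableSet ?_
  · refine h.congr' ?_
    filter_upwards [eventually_gt_atTop 0] with j hj
    rw [tsum_inter_inv_smul_span F hj, Fintype.card_fin]
  · refine (Metric.isBounded_closedBall (x := (0 : Fin n → ℝ)) (r := 1)).subset fun x hx => ?_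
    rw [mem_closedBall_zero_iff, pi_norm_le_iff_of_nonneg zero_le_one]
    intro i
    rw [Real.norm_eq_abs, ← sq_le_one_iff_abs_le_one]
    exact (single_le_sum (f := fun i => x i ^ 2) (fun _ _ => sq_nonneg _) (mem_univ i)).trans hx
  · rw [hs]
    exact ((convex_closedBall _ _).linear_preimage
      (EuclideanSpace.equiv (Fin n) ℝ).symm.toLinearMap).addHaar_frontier _

lemma eval_sq_div {A : ℕ} (q : MvPolynomial (Fin n) ℝ) (hq : q.IsHomogeneous A) (b : Fin n → ℝ)
    (j : ℝ) : MvPolynomial.eval (fun i => (b i / j) ^ 2) q =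
      MvPolynomial.eval (fun i => b i ^ 2) q / j ^ (2 * A) := by
  rw [MvPolynomial.eval_eq', MvPolynomial.eval_eq', sum_div]
  refine sum_congr rfl fun d hd => ?_
  have hdA := sum_eq_of_isHomogeneous hq hd
  simp_rw [div_pow, prod_div_distrib, ← pow_mul]
  rw [prod_pow_eq_pow_sum, ← mul_sum, hdA, mul_div_assoc]

lemma sharp_polynomial_sum {k A : ℕ} (q : MvPolynomial (Fin (k + 5)) ℝ)
    (hq : q.IsHomogeneous A) : ∃ C : ℝ, 0 ≤ C ∧ ∀ N : ℕ, 0 < N →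
    |(∑' b : Fin (k + 5) → ℤ, if ∑ i, (b i).natAbs ^ 2 ≤ N then
        MvPolynomial.eval (fun i => (b i : ℝ) ^ 2) q else 0) -
        (∫ x in Metric.closedBall (0 : EuclideanSpace ℝ (Fin (k + 5))) 1,
          MvPolynomial.eval (fun i => x i ^ 2) q) * (N : ℝ) ^ (((2 * A + k + 5 : ℕ) : ℝ) / 2)| ≤
      C * (N : ℝ) ^ (((2 * A + k + 5 : ℕ) : ℝ) / 2 - 1) := by
  obtain ⟨c, C, hC, h⟩ := exists_polynomial_sum_sub_le q hq
  suffices hc : c = ∫ x in Metric.closedBall (0 : EuclideanSpace ℝ (Fin (k + 5))) 1,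
      MvPolynomial.eval (fun i => x i ^ 2) q from ⟨C, hC, hc ▸ h⟩
  have hF : Continuous fun x : Fin (k + 5) → ℝ => MvPolynomial.eval (fun i => x i ^ 2) q :=
    (MvPolynomial.continuous_eval q).comp (by fun_prop)
  refine tendsto_nhds_unique ?_ (tendsto_lattice_sum_div_pow _ hF)
  set P := 2 * A + k + 5 with hP
  have hlim : Tendsto (fun j : ℕ => C * ((j : ℝ) ^ 2)⁻¹) atTop (nhds 0) := by
    have := ((tendsto_pow_atTop (two_ne_zero)).comp
      (tendsto_natCast_atTop_atTop (R := ℝ))).inv_tendsto_atTop.const_mul C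
    simpa using this
  rw [tendsto_iff_norm_sub_tendsto_zero]
  refine squeeze_zero' (Eventually.of_forall fun _ => norm_nonneg _) ?_ hlim
  filter_upwards [eventually_gt_atTop 0] with j hj
  have hj0 : (0 : ℝ) < j := by exact_mod_cast hj
  have h1 := h (j ^ 2) (by positivity)
  have e1 : ((j ^ 2 : ℕ) : ℝ) ^ ((P : ℝ) / 2) = (j : ℝ) ^ P := by
    rw [Nat.cast_pow, ← Real.rpow_natCast, ← Real.rpow_mul hj0.le, ← Real.rpow_natCast]
    congr 1; push_cast; ring
  rw [Real.rpow_sub_one (by positivity), e1] at h1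
  set S := ∑' b : Fin (k + 5) → ℤ, if ∑ i, (b i).natAbs ^ 2 ≤ j ^ 2 then
        MvPolynomial.eval (fun i => (b i : ℝ) ^ 2) q else 0 with hS
  have e2 : (∑' b : Fin (k + 5) → ℤ, if ∑ i, (b i).natAbs ^ 2 ≤ j ^ 2 then
      MvPolynomial.eval (fun i => ((b i : ℝ) / j) ^ 2) q else 0) = S / (j : ℝ) ^ (2 * A) := by
    rw [hS, ← tsum_div_const]
    refine tsum_congr fun b => ?_
    rw [eval_sq_div q hq]
    split_ifs <;> simp
  rw [e2, div_div, ← pow_add, ← add_assoc, ← hP]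
  have e3 : S / (j : ℝ) ^ P - c = (S - c * (j : ℝ) ^ P) / (j : ℝ) ^ P := by field_simp
  rw [e3, norm_div, Real.norm_eq_abs, Real.norm_of_nonneg (by positivity),
    div_le_iff₀ (by positivity)]
  refine h1.trans_eq ?_
  push_cast; ring

end

lemma rpow_sub_rpow_le {p x y : ℝ} (hp : 1 ≤ p) (hx : 0 < x) (hy : 0 ≤ y) :
    x ^ p - y ^ p ≤ p * (x - y) * x ^ (p - 1) := by
  have h := one_add_mul_self_le_rpow_one_add (s := y / x - 1)
    (by have : 0 ≤ y / x := by positivity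
        linarith) hp
  rw [add_sub_cancel, Real.div_rpow hy hx.le, le_div_iff₀ (by positivity)] at h
  rw [Real.rpow_sub_one hx.ne']
  have e : (1 + p * (y / x - 1)) * x ^ p = x ^ p - p * (x - y) * (x ^ p / x) := by
    field_simp; ring
  linarith

lemma abs_rpow_sub_rpow_le {p R x y : ℝ} (hp : 1 ≤ p) (hR : 0 ≤ R) (hx : 1 ≤ x) (hy : 0 < y)
    (h1 : x - 1 ≤ y) (h2 : y ≤ x + R) :
    |y ^ p - x ^ p| ≤ p * (1 + R) * ((1 + R) * x) ^ (p - 1) := by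
  have hx0 : 0 < x := by linarith
  have h3 : x ≤ (1 + R) * x := by nlinarith
  have h4 : y ≤ (1 + R) * x := by nlinarith
  have h5 : 0 ≤ p - 1 := by linarith
  have aux : ∀ {u v : ℝ}, 0 < u → 0 ≤ v → u - v ≤ 1 + R → u ≤ (1 + R) * x →
      u ^ p - v ^ p ≤ p * (1 + R) * ((1 + R) * x) ^ (p - 1) := fun {u v} hu hv huv hux => by
    refine (rpow_sub_rpow_le hp hu hv).trans ?_
    gcongr
  rw [abs_le]
  exact ⟨by linarith [aux hx0 hy.le (by linarith) h3], aux hy hx0.le (by linarith) h4⟩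

lemma isBigO_lattice_sum {k A : ℕ} (q : MvPolynomial (Fin (k + 5)) ℝ) (hq : q.IsHomogeneous A)
    {R : ℝ} (hR : 0 ≤ R) :
    (fun lam : ℝ => (∑' b : Fin (k + 5) → ℤ, if ∑ i, (b i : ℝ) ^ 2 ≤ lam + R then
        MvPolynomial.eval (fun i => (b i : ℝ) ^ 2) q else 0) -
        (∫ x in Metric.closedBall (0 : EuclideanSpace ℝ (Fin (k + 5))) 1,
          MvPolynomial.eval (fun i => x i ^ 2) q) * lam ^ (((2 * A + k + 5 : ℕ) : ℝ) / 2))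
      =O[atTop] fun lam : ℝ => lam ^ (((2 * A + k + 5 : ℕ) : ℝ) / 2 - 1) := by
  obtain ⟨C, hC, h⟩ := sharp_polynomial_sum q hq
  set c := ∫ x in Metric.closedBall (0 : EuclideanSpace ℝ (Fin (k + 5))) 1,
    MvPolynomial.eval (fun i => x i ^ 2) q
  set p : ℝ := ((2 * A + k + 5 : ℕ) : ℝ) / 2 with hp'
  have hp : 1 ≤ p := by
    rw [hp']; push_cast; linarith [(by positivity : (0 : ℝ) ≤ 2 * A + k)]
  refine IsBigO.of_bound (C * (1 + R) ^ (p - 1) + |c| * (p * (1 + R) * (1 + R) ^ (p - 1))) ?_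
  filter_upwards [eventually_ge_atTop 1] with x hx
  have hx0 : 0 < x := by linarith
  set N := ⌊x + R⌋₊ with hN
  have hN1 : 0 < N := Nat.floor_pos.2 (by linarith)
  have hN0 : (0 : ℝ) < N := by exact_mod_cast hN1
  have hN2 : (N : ℝ) ≤ x + R := Nat.floor_le (by linarith)
  have hN3 : x - 1 ≤ N := by have := Nat.lt_floor_add_one (x + R); linarith
  have e : (∑' b : Fin (k + 5) → ℤ, if ∑ i, (b i : ℝ) ^ 2 ≤ x + R then
        MvPolynomial.eval (fun i => (b i : ℝ) ^ 2) q else 0) =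
      ∑' b : Fin (k + 5) → ℤ, if ∑ i, (b i).natAbs ^ 2 ≤ N then
        MvPolynomial.eval (fun i => (b i : ℝ) ^ 2) q else 0 := by
    refine tsum_congr fun b => ?_
    congr 1
    rw [hN, Nat.le_floor_iff (by linarith)]
    push_cast
    simp_rw [Nat.cast_natAbs, Int.cast_abs, sq_abs]
  rw [e, Real.norm_eq_abs, Real.norm_of_nonneg (by positivity)]
  have h1 := h N hN1
  have h2 := abs_rpow_sub_rpow_le hp hR hx hN0 hN3 hN2
  have hp1 : 0 ≤ p - 1 := by linarith
  have h3 : (N : ℝ) ^ (p - 1) ≤ (1 + R) ^ (p - 1) * x ^ (p - 1) := by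
    rw [← Real.mul_rpow (by linarith) hx0.le]
    gcongr
    nlinarith
  rw [Real.mul_rpow (by linarith) hx0.le] at h2
  set S := ∑' b : Fin (k + 5) → ℤ, if ∑ i, (b i).natAbs ^ 2 ≤ N then
        MvPolynomial.eval (fun i => (b i : ℝ) ^ 2) q else 0
  calc |S - c * x ^ p| = |(S - c * (N : ℝ) ^ p) + c * ((N : ℝ) ^ p - x ^ p)| := by congr 1; ring
    _ ≤ C * (N : ℝ) ^ (p - 1) + |c| * |(N : ℝ) ^ p - x ^ p| := by
      rw [← abs_mul]; exact (abs_add_le _ _).trans (by gcongr)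
    _ ≤ C * ((1 + R) ^ (p - 1) * x ^ (p - 1)) +
        |c| * (p * (1 + R) * ((1 + R) ^ (p - 1) * x ^ (p - 1))) := by gcongr
    _ = _ := by ring

lemma card_filter_lt (n : ℕ) :
    2 * (univ.filter fun p : Fin n × Fin n => p.1 < p.2).card + n = n ^ 2 := by
  have h1 : (univ.filter fun p : Fin n × Fin n => p.1 < p.2).card =
      (univ.filter fun p : Fin n × Fin n => p.2 < p.1).card :=
    card_equiv (Equiv.prodComm _ _) (by simp)
  have h2 : (univ.filter fun p : Fin n × Fin n => p.1 = p.2).card = n := by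
    have : (univ.filter fun p : Fin n × Fin n => p.1 = p.2) = univ.diag := by ext ⟨a, b⟩; simp
    rw [this, diag_card, card_univ, Fintype.card_fin]
  have h3 : (univ : Finset (Fin n × Fin n)).card = n ^ 2 := by simp [sq]
  have h4 : (univ : Finset (Fin n × Fin n)) = univ.filter (fun p => p.1 < p.2) ∪
      univ.filter (fun p => p.2 < p.1) ∪ univ.filter (fun p => p.1 = p.2) := by
    ext ⟨a, b⟩; simp; rcases lt_trichotomy a b with h | h | h <;> tauto
  rw [h4, card_union_of_disjoint, card_union_of_disjoint, ← h1, h2] at h3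
  · omega
  · exact disjoint_filter.2 fun _ _ h h' => lt_asymm h h'
  · rw [disjoint_union_left]
    exact ⟨disjoint_filter.2 fun _ _ h h' => h.ne h', disjoint_filter.2 fun _ _ h h' => h.ne' h'⟩

/-- The numerator of the multiplicity polynomial, as a polynomial in the squared coordinates. -/
noncomputable def discPoly (n : ℕ) : MvPolynomial (Fin n) ℝ :=
  ∏ p ∈ univ.filter (fun p : Fin n × Fin n => p.1 < p.2),
    (MvPolynomial.X p.1 - MvPolynomial.X p.2) ^ 2

lemma discPoly_isHomogeneous (n : ℕ) : (discPoly n).IsHomogeneous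
    (2 * (univ.filter fun p : Fin n × Fin n => p.1 < p.2).card) := by
  have := MvPolynomial.IsHomogeneous.prod (univ.filter fun p : Fin n × Fin n => p.1 < p.2)
    (fun p => (MvPolynomial.X p.1 - MvPolynomial.X p.2 : MvPolynomial (Fin n) ℝ) ^ 2) (fun _ => 2)
    fun p _ => by
      simpa using ((MvPolynomial.isHomogeneous_X ℝ p.1).sub (MvPolynomial.isHomogeneous_X ℝ p.2)).pow 2
  simpa [discPoly, mul_comm] using this

lemma eval_discPoly (n : ℕ) (x : Fin n → ℝ) : MvPolynomial.eval x (discPoly n) =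
    ∏ p ∈ univ.filter (fun p : Fin n × Fin n => p.1 < p.2), (x p.1 - x p.2) ^ 2 := by
  simp [discPoly]

end WeylLaw

/-- **Sharp Weyl law for SO(2n), rank n ≥ 5 (Theorem 5.1, even orthogonal case).**
With `d = dim SO(2n) = n(2n−1)`, `ρ = (n−1, …, 1, 0)`, `a_j = n−j`, the multiplicity
polynomial `m(x) = ∏_{i<l}(x_i²−x_l²)²/∏_{j<l}(a_j²−a_l²)²`, and the spectral counting
function `𝓝(λ) = (2^{n−1} n!)⁻¹ Σ_{b∈ℤⁿ} m(b+ρ) 1_{|b+ρ|² ≤ λ+|ρ|²}`, one has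
`𝓝(λ) = C λ^{d/2} + O(λ^{(d−2)/2})` where `C = (2^{n−1} n!)⁻¹ ∫_{|x|≤1} m`. -/
theorem stmt10 (n : ℕ) (hn : 5 ≤ n) (d : ℕ) (hd : d = n * (2 * n - 1))
    (a : Fin n → ℝ) (ha : ∀ j, a j = (n : ℝ) - 1 - (j : ℕ))
    (ρ : EuclideanSpace ℝ (Fin n)) (hρ : ∀ j : Fin n, ρ j = (n : ℝ) - 1 - (j : ℕ))
    (m : EuclideanSpace ℝ (Fin n) → ℝ)
    (hm : ∀ x, m x =
      (∏ p ∈ Finset.univ.filter (fun p : Fin n × Fin n => p.1 < p.2),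
          (x p.1 ^ 2 - x p.2 ^ 2) ^ 2) /
      (∏ p ∈ Finset.univ.filter (fun p : Fin n × Fin n => p.1 < p.2),
          (a p.1 ^ 2 - a p.2 ^ 2) ^ 2))
    (𝓝 : ℝ → ℝ)
    (h𝓝 : ∀ lam : ℝ, 𝓝 lam = (1 / ((2 : ℝ) ^ (n - 1) * n.factorial)) *
      ∑' b : Fin n → ℤ,
        if ‖((EuclideanSpace.equiv (Fin n) ℝ).symm fun i => (b i : ℝ) + ρ i)‖ ^ 2
            ≤ lam + ‖ρ‖ ^ 2 then
          m ((EuclideanSpace.equiv (Fin n) ℝ).symm fun i => (b i : ℝ) + ρ i) else 0)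
    (C : ℝ)
    (hC : C = (1 / ((2 : ℝ) ^ (n - 1) * n.factorial)) *
      ∫ x in Metric.closedBall (0 : EuclideanSpace ℝ (Fin n)) 1, m x) :
    (fun lam : ℝ => 𝓝 lam - C * lam ^ ((d : ℝ) / 2))
      =O[atTop] (fun lam : ℝ => lam ^ (((d : ℝ) - 2) / 2)) := by
  obtain ⟨k, rfl⟩ : ∃ k, n = k + 5 := ⟨n - 5, by omega⟩
  set A := 2 * (univ.filter fun p : Fin (k + 5) × Fin (k + 5) => p.1 < p.2).card with hA
  have hdA : d = 2 * A + k + 5 := by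
    have := WeylLaw.card_filter_lt (k + 5)
    obtain ⟨e, he⟩ : ∃ e, 2 * (k + 5) - 1 = e ∧ e + 1 = 2 * (k + 5) := ⟨_, rfl, by omega⟩
    rw [hd, he.1]
    nlinarith [he.2]
  set w : ℝ := 1 / ((2 : ℝ) ^ (k + 5 - 1) * (k + 5).factorial)
  set D : ℝ := ∏ p ∈ univ.filter (fun p : Fin (k + 5) × Fin (k + 5) => p.1 < p.2),
    (a p.1 ^ 2 - a p.2 ^ 2) ^ 2
  set q := WeylLaw.discPoly (k + 5)
  have hmq : ∀ x, m x = MvPolynomial.eval (fun i => x i ^ 2) q / D := fun x => by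
    rw [hm, WeylLaw.eval_discPoly]
  set r : Fin (k + 5) → ℤ := fun j => k + 4 - (j : ℕ) with hr
  have hρr : ∀ j, ρ j = r j := fun j => by rw [hρ, hr]; push_cast; ring
  have hsum : ∀ lam, 𝓝 lam = w / D * ∑' b : Fin (k + 5) → ℤ,
      if ∑ i, (b i : ℝ) ^ 2 ≤ lam + ‖ρ‖ ^ 2 then
        MvPolynomial.eval (fun i => (b i : ℝ) ^ 2) q else 0 := fun lam => by
    rw [h𝓝, div_mul_eq_mul_div w D, mul_div_assoc w, ← tsum_div_const]
    congr 1
    refine Eq.trans ?_ ((Equiv.addRight r).tsum_eq _)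
    refine tsum_congr fun b => ?_
    rw [hmq, EuclideanSpace.real_norm_sq_eq]
    simp only [hρr, Equiv.coe_addRight, Pi.add_apply, Int.cast_add, ite_div, zero_div]
    rfl
  have hCq : C = w / D * ∫ x in Metric.closedBall (0 : EuclideanSpace ℝ (Fin (k + 5))) 1,
      MvPolynomial.eval (fun i => x i ^ 2) q := by
    rw [hC]
    simp_rw [hmq]
    rw [integral_div]; ring
  have key := (WeylLaw.isBigO_lattice_sum q (WeylLaw.discPoly_isHomogeneous _)
    (sq_nonneg ‖ρ‖)).const_mul_left (w / D)
  rw [← hA, ← hdA] at key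
  refine (key.congr_left fun lam => ?_).congr_right fun lam => ?_
  · rw [hsum, hCq]; ring
  · congr 1; ring
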